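/- arXiv:2411.07761 — 3 statements merged into one kernel-verified Lean document; each statement's English description precedes it below -/
import Mathlib

section
/- Let f belong to the class S, with Taylor coefficients a_n = f⁽ⁿ⁾(0)/n!. Then |a₂| ≤ 2, and |a₂| = 2 if and only if f is a rotation of the Koebe function, i.e. there exists θ ∈ ℝ such that f(z) = e^{−iθ}·k(e^{iθ}z) for all z in the unit disc, where k(z) = z/(1−z)². -/
open Metric

open MeasureTheory Set Real in
/-- Integration over a closed annulus in polar coordinates. -/
theorem setIntegral_annulus_eq_integral_circleAverage {F : ℂ → ℝ} {r ρ : ℝ} (hr : 0 < r)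
    (hF : ContinuousOn F (closedBall 0 ρ \ ball 0 r)) :
    ∫ z in closedBall 0 ρ \ ball 0 r, F z =
      2 * π * ∫ s in Icc r ρ, s * Real.circleAverage F 0 s := by
  have hmaps : MapsTo (fun p : ℝ × ℝ ↦ circleMap 0 p.1 p.2) (Icc r ρ ×ˢ univ)
      (closedBall 0 ρ \ ball 0 r) := by
    rintro ⟨s, θ⟩ ⟨⟨h1, h2⟩, -⟩
    simp only at h1 h2
    have : |s| = s := abs_of_pos (hr.trans_le h1)
    simp [this, h1, h2]
  have hcont : ContinuousOn (fun p : ℝ × ℝ ↦ p.1 * F (circleMap 0 p.1 p.2))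
      (Icc r ρ ×ˢ univ) :=
    continuousOn_fst.mul (hF.comp circleMap.continuous.continuousOn hmaps)
  have hset : polarCoord.target ∩ (Icc r ρ ×ˢ univ) = Icc r ρ ×ˢ Ioo (-π) π := by
    ext ⟨s, θ⟩
    simp only [polarCoord_target, mem_inter_iff, mem_prod, mem_Ioi, mem_Ioo, mem_Icc, mem_univ]
    constructor
    · tauto
    · rintro ⟨h1, h2⟩
      exact ⟨⟨hr.trans_le h1.1, h2⟩, h1, trivial⟩
  have hmeas : MeasurableSet (Icc r ρ ×ˢ (univ : Set ℝ)) := measurableSet_Icc.prod .univ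
  calc ∫ z in closedBall 0 ρ \ ball 0 r, F z
      = ∫ z, (closedBall 0 ρ \ ball 0 r).indicator F z :=
        (integral_indicator (measurableSet_closedBall.diff measurableSet_ball)).symm
    _ = ∫ p in polarCoord.target, p.1 • (closedBall 0 ρ \ ball 0 r).indicator F
          (Complex.polarCoord.symm p) := (Complex.integral_comp_polarCoord_symm _).symm
    _ = ∫ p in polarCoord.target, (Icc r ρ ×ˢ univ).indicator
          (fun p : ℝ × ℝ ↦ p.1 * F (circleMap 0 p.1 p.2)) p := by
        refine setIntegral_congr_fun polarCoord.open_target.measurableSet ?_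
        rintro ⟨s, θ⟩ ⟨hs, -⟩
        simp only [mem_Ioi] at hs
        have hcm : Complex.polarCoord.symm (s, θ) = circleMap 0 s θ := by
          simp [circleMap, Complex.exp_mul_I]
        have hmem : circleMap 0 s θ ∈ closedBall (0 : ℂ) ρ \ ball 0 r ↔ s ∈ Icc r ρ := by
          simp [abs_of_pos hs, and_comm]
        by_cases h : s ∈ Icc r ρ
        · simp [hcm, indicator_of_mem (hmem.2 h), h.1, h.2]
        · simp only [hcm, indicator_of_notMem (mt hmem.1 h), smul_zero]
          rw [indicator_of_notMem fun h' ↦ h h'.1]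
    _ = ∫ p in Icc r ρ ×ˢ Ioo (-π) π, p.1 * F (circleMap 0 p.1 p.2) := by
        rw [setIntegral_indicator hmeas, hset]
    _ = ∫ s in Icc r ρ, ∫ θ in Ioo (-π) π, s * F (circleMap 0 s θ) := by
        refine setIntegral_prod _ ?_
        refine ((hcont.mono (prod_mono_right (subset_univ (Icc (-π) π)))).integrableOn_compact
          (isCompact_Icc.prod isCompact_Icc)).mono_set (prod_mono_right Ioo_subset_Icc_self)
    _ = ∫ s in Icc r ρ, 2 * π * (s * Real.circleAverage F 0 s) := by
        congr! 2 with s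
        have hper : Function.Periodic (fun θ ↦ F (circleMap 0 s θ)) (2 * π) :=
          fun θ ↦ by simp [periodic_circleMap 0 s θ]
        have := hper.intervalIntegral_add_eq (-π) 0
        rw [show -π + 2 * π = π by ring, zero_add] at this
        rw [integral_const_mul, ← integral_Ioc_eq_integral_Ioo,
          ← intervalIntegral.integral_of_le (by linarith [pi_pos]), this,
          Real.circleAverage_def, smul_eq_mul]
        field_simp
    _ = _ := integral_const_mul _ _

/-- The real determinant of multiplication by a complex number. -/
theorem Complex.det_restrictScalars_toSpanSingleton (a : ℂ) :
    ((ContinuousLinearMap.toSpanSingleton ℂ a).restrictScalars ℝ).det = ‖a‖ ^ 2 := by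
  rw [ContinuousLinearMap.det, ← LinearMap.det_toMatrix basisOneI, Matrix.det_fin_two,
    ← normSq_eq_norm_sq, normSq_apply]
  simp [LinearMap.toMatrix_apply]

/-- The area of an injective holomorphic image. -/
theorem Complex.volume_real_image_eq_setIntegral_norm_deriv_sq {G : ℂ → ℂ} {U s : Set ℂ}
    (hU : IsOpen U) (hG : DifferentiableOn ℂ G U) (hs : MeasurableSet s) (hsU : s ⊆ U)
    (hinj : Set.InjOn G s) :
    MeasureTheory.volume.real (G '' s) = ∫ z in s, ‖deriv G z‖ ^ 2 := by
  have := MeasureTheory.integral_image_eq_integral_abs_det_fderiv_smul MeasureTheory.volume hs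
    (fun z hz ↦ ((hG.differentiableAt (hU.mem_nhds (hsU hz))).hasDerivAt.hasFDerivAt.restrictScalars
      ℝ).hasFDerivWithinAt) hinj (fun _ ↦ (1 : ℝ))
  simpa [Complex.det_restrictScalars_toSpanSingleton] using this

/-- The real determinant of the map `w ↦ w - c * conj w`. -/
theorem Complex.det_id_sub_mul_conj (c : ℂ) :
    LinearMap.det (LinearMap.id - (LinearMap.mulLeft ℝ c) ∘ₗ Complex.conjAe.toLinearMap) =
      1 - ‖c‖ ^ 2 := by
  rw [← LinearMap.det_toMatrix basisOneI, Matrix.det_fin_two, ← normSq_eq_norm_sq, normSq_apply]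
  simp [LinearMap.toMatrix_apply]
  ring

/-- The area of the preimage of a disc under `w ↦ w - c * conj w`. -/
theorem Complex.volume_setOf_norm_sub_mul_conj_le {c : ℂ} (hc : ‖c‖ < 1) {M : ℝ}
    (hM : 0 ≤ M) :
    MeasureTheory.volume {w : ℂ | ‖w - c * starRingEnd ℂ w‖ ≤ M} =
      ENNReal.ofReal (Real.pi * M ^ 2 / (1 - ‖c‖ ^ 2)) := by
  have hpos : 0 < 1 - ‖c‖ ^ 2 := by nlinarith [norm_nonneg c]
  have hdet := det_id_sub_mul_conj c
  have := MeasureTheory.Measure.addHaar_preimage_linearMap MeasureTheory.volume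
    (hdet.trans_ne hpos.ne') (closedBall 0 M)
  rw [hdet, abs_of_pos (inv_pos.2 hpos), Complex.volume_closedBall] at this
  convert this using 1
  · congr 1
    ext w
    simp
  · rw [← NNReal.coe_real_pi, ← ENNReal.ofReal_coe_nnreal, ← ENNReal.ofReal_pow hM,
      ← ENNReal.ofReal_mul (by positivity), ← ENNReal.ofReal_mul (by positivity)]
    congr 1
    field_simp

/-- If `u` is continuous on a closed disc, open on the disc, and vanishes at the centre, then a
point whose segment to `0` misses the image of the boundary circle is in the image. -/
theorem mem_image_ball_of_segment_disjoint_image_sphere {u : ℂ → ℂ} {r : ℝ} (hr : 0 < r)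
    (hu : ContinuousOn u (closedBall 0 r)) (hopen : IsOpen (u '' ball 0 r)) (hu0 : u 0 = 0)
    {v : ℂ} (hv : ∀ t ∈ Set.Icc (0 : ℝ) 1, (t : ℂ) * v ∉ u '' sphere 0 r) :
    v ∈ u '' ball 0 r := by
  have hpre : IsPreconnected ((fun t : ℝ ↦ (t : ℂ) * v) '' Set.Icc 0 1) :=
    isPreconnected_Icc.image _ (by fun_prop)
  have hclosed : IsClosed (u '' closedBall 0 r) :=
    ((isCompact_closedBall 0 r).image_of_continuousOn hu).isClosed
  refine hpre.subset_of_closure_inter_subset hopen ⟨0, ⟨0, by simp, by simp⟩, 0, by simpa, hu0⟩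
    ?_ ⟨1, by simp, by simp⟩
  rintro _ ⟨h1, t, ht, rfl⟩
  obtain ⟨z, hz, hzt⟩ := closure_minimal (Set.image_mono ball_subset_closedBall) hclosed h1
  rcases (mem_closedBall.1 hz).lt_or_eq with h | h
  · exact ⟨z, h, hzt⟩
  · exact absurd ⟨z, h, hzt⟩ (hv t ht)

open MeasureTheory Set in
/-- The integral of `‖-1 / z ^ 2 + h z‖ ^ 2` over an annulus, for `h` holomorphic on the disc. -/
theorem setIntegral_annulus_norm_neg_inv_sq_add {h : ℂ → ℂ}
    (hh : DifferentiableOn ℂ h (ball 0 1)) {r ρ : ℝ} (hr : 0 < r) (hrρ : r ≤ ρ) (hρ : ρ < 1) :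
    ∫ z in closedBall 0 ρ \ ball 0 r, ‖-(z ^ 2)⁻¹ + h z‖ ^ 2 =
      Real.pi * ((r ^ 2)⁻¹ - (ρ ^ 2)⁻¹) + Real.pi * ‖h 0‖ ^ 2 * (ρ ^ 2 - r ^ 2) +
        ∫ z in closedBall 0 ρ \ ball 0 r, ‖h z - h 0‖ ^ 2 := by
  have hsub : closedBall (0 : ℂ) ρ \ ball 0 r ⊆ ball 0 1 :=
    sdiff_subset.trans (closedBall_subset_ball hρ)
  have hne : ∀ z ∈ closedBall (0 : ℂ) ρ \ ball 0 r, z ≠ 0 := by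
    rintro z ⟨-, hz⟩ rfl
    exact hz (mem_ball_self hr)
  have hcpt : IsCompact (closedBall (0 : ℂ) ρ \ ball 0 r) :=
    (isCompact_closedBall 0 ρ).diff isOpen_ball
  have hhc : ContinuousOn h (closedBall 0 ρ \ ball 0 r) := hh.continuousOn.mono hsub
  have hinv : ContinuousOn (fun z : ℂ ↦ (z ^ 2)⁻¹) (closedBall 0 ρ \ ball 0 r) :=
    ContinuousOn.inv₀ (by fun_prop) fun z hz ↦ pow_ne_zero 2 (hne z hz)
  set Φ : ℂ → ℝ := fun z ↦ ‖-(z ^ 2)⁻¹ + h z‖ ^ 2 - ‖h z - h 0‖ ^ 2 with hΦ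
  have hc1 : ContinuousOn (fun z ↦ ‖-(z ^ 2)⁻¹ + h z‖ ^ 2) (closedBall 0 ρ \ ball 0 r) :=
    (hinv.neg.add hhc).norm.pow 2
  have hc2 : ContinuousOn (fun z ↦ ‖h z - h 0‖ ^ 2) (closedBall 0 ρ \ ball 0 r) :=
    (hhc.sub continuousOn_const).norm.pow 2
  have hΦc : ContinuousOn Φ (closedBall 0 ρ \ ball 0 r) := hc1.sub hc2
  have havg : ∀ s ∈ Icc r ρ, Real.circleAverage Φ 0 s = (s ^ 4)⁻¹ + ‖h 0‖ ^ 2 := by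
    rintro s ⟨hs1, hs2⟩
    have hs : 0 < s := hr.trans_le hs1
    set K : ℂ → ℂ := fun z ↦ ((s ^ 4)⁻¹ + ‖h 0‖ ^ 2 : ℝ) +
      2 * (-(z ^ 2 * h z) / (s : ℂ) ^ 4 + starRingEnd ℂ (h 0) * (h z - h 0)) with hK
    have hKd : DifferentiableOn ℂ K (ball 0 1) := by fun_prop
    have hKcl : DiffContOnCl ℂ K (ball 0 |s|) := by
      refine DifferentiableOn.diffContOnCl (hKd.mono ?_)
      rw [abs_of_pos hs]
      exact closure_ball_subset_closedBall.trans (closedBall_subset_ball (hs2.trans_lt hρ))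
    have hKi : CircleIntegrable K 0 s := by
      refine ContinuousOn.circleIntegrable hs.le (hKd.continuousOn.mono ?_)
      exact sphere_subset_closedBall.trans (closedBall_subset_ball (hs2.trans_lt hρ))
    have hre := Complex.reCLM.circleAverage_comp_comm hKi
    rw [hKcl.circleAverage] at hre
    rw [Real.circleAverage_congr_sphere (f₂ := Complex.reCLM ∘ K), hre]
    · simp [hK, ← Complex.ofReal_pow]
    · intro z hz
      rw [abs_of_pos hs, mem_sphere_zero_iff_norm] at hz
      have hz0 : z ≠ 0 := norm_pos_iff.1 (hz ▸ hs)
      have hconj : starRingEnd ℂ (z ^ 2)⁻¹ = z ^ 2 / (s : ℂ) ^ 4 := by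
        have : z * starRingEnd ℂ z = (s : ℂ) ^ 2 := by rw [Complex.mul_conj', hz]
        have hzc : starRingEnd ℂ z ≠ 0 := by simpa using hz0
        have hs' : (s : ℂ) ^ 4 ≠ 0 := by simp [hs.ne']
        rw [map_inv₀, map_pow, eq_div_iff hs', show (s : ℂ) ^ 4 = ((s : ℂ) ^ 2) ^ 2 by ring,
          ← this]
        field_simp
      have hn : Complex.normSq (z ^ 2)⁻¹ = (s ^ 4)⁻¹ := by
        simp [Complex.normSq_eq_norm_sq, hz, ← pow_mul]
      have hKz : K z = ((s ^ 4)⁻¹ + ‖h 0‖ ^ 2 : ℝ) +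
          2 * (-(starRingEnd ℂ (z ^ 2)⁻¹ * h z) + starRingEnd ℂ (h 0) * (h z - h 0)) := by
        rw [hconj, hK]
        ring
      simp only [Function.comp_apply, Complex.reCLM_apply, hKz, hΦ, ← hn,
        ← Complex.normSq_eq_norm_sq]
      generalize (z ^ 2)⁻¹ = q
      simp [Complex.normSq_apply]
      ring
  have hrad : ∫ s in Icc r ρ, s * ((s ^ 4)⁻¹ + ‖h 0‖ ^ 2) =
      ((r ^ 2)⁻¹ - (ρ ^ 2)⁻¹) / 2 + ‖h 0‖ ^ 2 * (ρ ^ 2 - r ^ 2) / 2 := by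
    have hpos : ∀ s ∈ uIcc r ρ, s ≠ 0 := fun s hs ↦ by
      rw [uIcc_of_le hrρ] at hs
      exact (hr.trans_le hs.1).ne'
    rw [integral_Icc_eq_integral_Ioc, ← intervalIntegral.integral_of_le hrρ,
      intervalIntegral.integral_eq_sub_of_hasDerivAt
        (f := fun s ↦ -(s ^ 2)⁻¹ / 2 + ‖h 0‖ ^ 2 * s ^ 2 / 2)]
    · ring
    · intro s hs
      have := hpos s hs
      refine ((((hasDerivAt_pow 2 s).inv (pow_ne_zero 2 this)).neg.div_const 2).add
        (((hasDerivAt_pow 2 s).const_mul (‖h 0‖ ^ 2)).div_const 2)).congr_deriv ?_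
      field_simp
      norm_num
      ring
    · refine ContinuousOn.intervalIntegrable ?_
      have : ContinuousOn (fun s : ℝ ↦ (s ^ 4)⁻¹) (uIcc r ρ) :=
        ContinuousOn.inv₀ (by fun_prop) fun s hs ↦ pow_ne_zero 4 (hpos s hs)
      fun_prop
  have hsum : ∫ z in closedBall 0 ρ \ ball 0 r, Φ z =
      Real.pi * ((r ^ 2)⁻¹ - (ρ ^ 2)⁻¹) + Real.pi * ‖h 0‖ ^ 2 * (ρ ^ 2 - r ^ 2) := by
    rw [setIntegral_annulus_eq_integral_circleAverage hr hΦc,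
      setIntegral_congr_fun measurableSet_Icc (g := fun s ↦ s * ((s ^ 4)⁻¹ + ‖h 0‖ ^ 2))
        fun s hs ↦ by simp only [havg s hs], hrad]
    ring
  rw [← hsum, hΦ, integral_sub (hc1.integrableOn_compact hcpt) (hc2.integrableOn_compact hcpt)]
  ring

open Filter Topology in
/-- A first-order Taylor estimate with quadratic remainder for a holomorphic function vanishing at
the origin. -/
theorem exists_norm_sub_deriv_mul_le {H : ℂ → ℂ} (hH : DifferentiableOn ℂ H (ball 0 1))
    (hH0 : H 0 = 0) :
    ∃ C, 0 ≤ C ∧ ∀ z ∈ closedBall (0 : ℂ) (1 / 2), ‖H z - deriv H 0 * z‖ ≤ C * ‖z‖ ^ 2 := by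
  have hnhds : ball (0 : ℂ) 1 ∈ 𝓝 0 := ball_mem_nhds 0 one_pos
  have hE : DifferentiableOn ℂ (dslope (dslope H 0) 0) (ball 0 1) :=
    (Complex.differentiableOn_dslope hnhds).2 ((Complex.differentiableOn_dslope hnhds).2 hH)
  obtain ⟨C, hC⟩ := (isCompact_closedBall (0 : ℂ) (1 / 2)).exists_bound_of_continuousOn
    (hE.continuousOn.mono (closedBall_subset_ball (by norm_num)))
  refine ⟨C, (norm_nonneg _).trans (hC 0 (by simp)), fun z hz ↦ ?_⟩
  have h1 : z * dslope H 0 z = H z := by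
    simpa [hH0] using sub_smul_dslope H 0 z
  have h2 : z * dslope (dslope H 0) 0 z = dslope H 0 z - deriv H 0 := by
    simpa using sub_smul_dslope (dslope H 0) 0 z
  have : H z - deriv H 0 * z = z ^ 2 * dslope (dslope H 0) 0 z := by
    linear_combination -h1 - z * h2
  rw [this, norm_mul, norm_pow, mul_comm]
  exact mul_le_mul_of_nonneg_right (hC z hz) (by positivity)

/-- If `1 / u` and `1 / z + H z` agree on the punctured disc, then the `ℝ`-linear map straightening
the ellipse approximating the image of the circle of radius `r` bounds the image of the rest of
the disc. -/
theorem norm_sub_mul_conj_le_of_injOn {u G : ℂ → ℂ} (hu : DifferentiableOn ℂ u (ball 0 1))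
    (hinj : Set.InjOn u (ball 0 1)) (hu0 : u 0 = 0)
    (huG : ∀ z ∈ ball (0 : ℂ) 1, z ≠ 0 → (u z)⁻¹ = G z)
    {r M : ℝ} (hr : 0 < r) (hr1 : r < 1) (c : ℂ)
    (hM : ∀ z ∈ sphere (0 : ℂ) r, ‖G z - c * starRingEnd ℂ (G z)‖ ≤ M)
    {z : ℂ} (hz : z ∈ ball (0 : ℂ) 1) (hzr : r ≤ ‖z‖) :
    ‖G z - c * starRingEnd ℂ (G z)‖ ≤ M := by
  by_contra! hlt
  have hz0 : z ≠ 0 := norm_pos_iff.1 (hr.trans_le hzr)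
  have hsub : closedBall (0 : ℂ) r ⊆ ball 0 1 := closedBall_subset_ball hr1
  have hopen : IsOpen (u '' ball 0 r) := by
    have han : AnalyticOnNhd ℂ u (ball 0 1) := hu.analyticOnNhd isOpen_ball
    rcases han.is_constant_or_isOpen (convex_ball 0 1).isPreconnected with ⟨w, hw⟩ | h
    · have h0 : (0 : ℂ) ∈ ball (0 : ℂ) 1 := by simp
      exact absurd (hinj hz h0 ((hw z hz).trans (hw 0 h0).symm)) hz0
    · exact h _ (ball_subset_ball hr1.le) isOpen_ball
  have hmem : u z ∈ u '' ball 0 r := by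
    refine mem_image_ball_of_segment_disjoint_image_sphere hr (hu.continuousOn.mono hsub) hopen
      hu0 ?_
    rintro t ⟨ht0, ht1⟩ ⟨y, hy, hyt⟩
    have hyM := hM y hy
    have hy1 : y ∈ ball (0 : ℂ) 1 := hsub (sphere_subset_closedBall hy)
    have hy0 : y ≠ 0 := norm_pos_iff.1 ((mem_sphere_zero_iff_norm.1 hy).symm ▸ hr)
    have hGy : G y = (t : ℂ)⁻¹ * G z := by rw [← huG y hy1 hy0, hyt, mul_inv, huG z hz hz0]
    have ht : 0 < t := by
      refine ht0.lt_of_ne' fun ht ↦ hy0 (hinj hy1 (by simp) ?_)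
      rw [hyt, hu0, ht]
      simp
    have hscale : G y - c * starRingEnd ℂ (G y) =
        (t : ℂ)⁻¹ * (G z - c * starRingEnd ℂ (G z)) := by
      rw [hGy, map_mul, map_inv₀, Complex.conj_ofReal]
      ring
    rw [hscale, norm_mul, norm_inv, Complex.norm_of_nonneg ht0] at hyM
    have := le_mul_of_one_le_left (norm_nonneg (G z - c * starRingEnd ℂ (G z)))
      ((one_le_inv₀ ht).2 ht1)
    linarith
  obtain ⟨y, hy, hyz⟩ := hmem
  have := hinj (ball_subset_ball hr1.le hy) hz hyz
  rw [this, mem_ball_zero_iff] at hy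
  linarith

/-- An upper bound for the area of the image of an annulus under `1 / u = 1 / z + H z`. -/
theorem setIntegral_annulus_norm_deriv_sq_le {u H : ℂ → ℂ} (hu : DifferentiableOn ℂ u (ball 0 1))
    (hinj : Set.InjOn u (ball 0 1)) (hu0 : u 0 = 0) (hH : DifferentiableOn ℂ H (ball 0 1))
    (huH : ∀ z ∈ ball (0 : ℂ) 1, z ≠ 0 → (u z)⁻¹ = z⁻¹ + H z)
    {r ρ M : ℝ} (hr : 0 < r) (hrρ : r ≤ ρ) (hρ : ρ < 1) {c : ℂ} (hc : ‖c‖ < 1)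
    (hM : ∀ z ∈ sphere (0 : ℂ) r,
      ‖z⁻¹ + H z - c * starRingEnd ℂ (z⁻¹ + H z)‖ ≤ M) :
    ∫ z in closedBall 0 ρ \ ball 0 r, ‖-(z ^ 2)⁻¹ + deriv H z‖ ^ 2 ≤
      Real.pi * M ^ 2 / (1 - ‖c‖ ^ 2) := by
  have hM0 : 0 ≤ M := (norm_nonneg _).trans (hM r (by simp [hr.le]))
  have hsub : closedBall (0 : ℂ) ρ \ ball 0 r ⊆ ball 0 1 \ {0} := by
    rintro z ⟨hz1, hz2⟩
    refine ⟨closedBall_subset_ball hρ hz1, ?_⟩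
    rintro rfl
    exact hz2 (mem_ball_self hr)
  have hmeas : MeasurableSet (closedBall (0 : ℂ) ρ \ ball 0 r) :=
    measurableSet_closedBall.diff measurableSet_ball
  have hopen : IsOpen (ball (0 : ℂ) 1 \ {0}) := isOpen_ball.sdiff isClosed_singleton
  have hder : ∀ z ∈ ball (0 : ℂ) 1 \ {0},
      HasDerivAt (fun z ↦ z⁻¹ + H z) (-(z ^ 2)⁻¹ + deriv H z) z := fun z hz ↦
    (hasDerivAt_inv hz.2).add (hH.differentiableAt (isOpen_ball.mem_nhds hz.1)).hasDerivAt
  have hGinj : Set.InjOn (fun z ↦ z⁻¹ + H z) (closedBall (0 : ℂ) ρ \ ball 0 r) := by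
    intro z hz w hw hzw
    refine hinj (hsub hz).1 (hsub hw).1 (inv_injective ?_)
    rw [huH z (hsub hz).1 (hsub hz).2, huH w (hsub hw).1 (hsub hw).2]
    exact hzw
  have harea := Complex.volume_real_image_eq_setIntegral_norm_deriv_sq hopen
    (fun z hz ↦ (hder z hz).differentiableAt.differentiableWithinAt) hmeas hsub hGinj
  rw [MeasureTheory.setIntegral_congr_fun hmeas
    (g := fun z ↦ ‖-(z ^ 2)⁻¹ + deriv H z‖ ^ 2)
    fun z hz ↦ by simp only [(hder z (hsub hz)).deriv]] at harea
  have hpos : 0 < 1 - ‖c‖ ^ 2 := by nlinarith [norm_nonneg c]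
  rw [← harea]
  refine ENNReal.toReal_le_of_le_ofReal (by positivity) ?_
  rw [← Complex.volume_setOf_norm_sub_mul_conj_le hc hM0]
  refine MeasureTheory.measure_mono ?_
  rintro _ ⟨z, hz, rfl⟩
  exact norm_sub_mul_conj_le_of_injOn hu hinj hu0 huH hr (hrρ.trans_lt hρ) c hM (hsub hz).1
    (by simpa using hz.2)

open Filter Topology MeasureTheory in
/-- The area theorem on a closed annulus. -/
theorem area_theorem_annulus {u H : ℂ → ℂ} (hu : DifferentiableOn ℂ u (ball 0 1))
    (hinj : Set.InjOn u (ball 0 1)) (hu0 : u 0 = 0) (hH : DifferentiableOn ℂ H (ball 0 1))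
    (hH0 : H 0 = 0) (huH : ∀ z ∈ ball (0 : ℂ) 1, z ≠ 0 → (u z)⁻¹ = z⁻¹ + H z)
    {r₀ ρ : ℝ} (hr₀ : 0 < r₀) (hrρ : r₀ ≤ ρ) (hρ : ρ < 1) :
    Real.pi * ‖deriv H 0‖ ^ 2 + ∫ z in closedBall 0 ρ \ ball 0 r₀, ‖deriv H z - deriv H 0‖ ^ 2 ≤
      Real.pi := by
  have hdH : DifferentiableOn ℂ (deriv H) (ball 0 1) := hH.deriv isOpen_ball
  have hintegrable : ∀ r ρ : ℝ, ρ < 1 →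
      IntegrableOn (fun z ↦ ‖deriv H z - deriv H 0‖ ^ 2) (closedBall 0 ρ \ ball 0 r) := by
    intro r ρ hρ
    refine ContinuousOn.integrableOn_compact ((isCompact_closedBall 0 ρ).diff isOpen_ball) ?_
    refine ((hdH.continuousOn.sub continuousOn_const).norm.pow 2).mono ?_
    exact Set.sdiff_subset.trans (closedBall_subset_ball hρ)
  set J := ∫ z in closedBall 0 ρ \ ball 0 r₀, ‖deriv H z - deriv H 0‖ ^ 2 with hJ
  set b := deriv H 0 with hb
  obtain ⟨C, hC0, hC⟩ := exists_norm_sub_deriv_mul_le hH hH0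
  rw [← hb] at hC
  set D := C + ‖b‖ ^ 2 + ‖b‖ * C with hD
  have hD0 : 0 ≤ D := by positivity
  have hboundary : ∀ r : ℝ, 0 < r → r ≤ 1 / 2 → ∀ z ∈ sphere (0 : ℂ) r,
      ‖z⁻¹ + H z - b * r ^ 2 * starRingEnd ℂ (z⁻¹ + H z)‖ ≤ r⁻¹ + D * r ^ 2 := by
    intro r hr hr2 z hz
    have hz' : ‖z‖ = r := mem_sphere_zero_iff_norm.1 hz
    have hz0 : z ≠ 0 := norm_pos_iff.1 (hz' ▸ hr)
    have hR := hC z (mem_closedBall_zero_iff.2 (hz'.trans_le hr2))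
    rw [hz'] at hR
    have hconj : (r : ℂ) ^ 2 * starRingEnd ℂ z⁻¹ = z := by
      have hzc : starRingEnd ℂ z ≠ 0 := by simpa using hz0
      rw [← hz', ← Complex.mul_conj', map_inv₀, mul_inv_cancel_right₀ hzc]
    have heq : z⁻¹ + H z - b * r ^ 2 * starRingEnd ℂ (z⁻¹ + H z) =
        z⁻¹ + (H z - b * z) - b * r ^ 2 * (starRingEnd ℂ (b * z) +
          starRingEnd ℂ (H z - b * z)) := by
      rw [map_add, map_sub]
      linear_combination -b * hconj
    have hbr : ‖b * (r : ℂ) ^ 2‖ = ‖b‖ * r ^ 2 := by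
      rw [norm_mul, norm_pow, Complex.norm_of_nonneg hr.le]
    rw [heq]
    refine (norm_sub_le _ _).trans ((add_le_add (norm_add_le _ _)
      (c := ‖b * (r : ℂ) ^ 2 * _‖) (d := ‖b‖ * r ^ 2 * (‖b‖ * r + C * r ^ 2)) ?_).trans ?_)
    · rw [norm_mul, hbr]
      gcongr
      refine (norm_add_le _ _).trans (add_le_add ?_ ?_)
      · rw [RCLike.norm_conj, norm_mul, hz']
      · rwa [RCLike.norm_conj]
    · rw [norm_inv, hz', hD]
      have h1 : ‖b‖ * r ^ 2 * (‖b‖ * r + C * r ^ 2) ≤ ‖b‖ * r ^ 2 * (‖b‖ * 1 + C * 1) := by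
        gcongr
        · linarith
        · nlinarith
      linarith
  -- The area comparison, cleared of denominators in `r`.
  have hcmp : ∀ ρ' : ℝ, ρ ≤ ρ' → ρ' < 1 → ∀ r : ℝ, 0 < r → r ≤ r₀ → r ≤ 1 / 2 → ‖b‖ * r ^ 2 < 1 →
      (Real.pi * ‖b‖ ^ 2 * (ρ' ^ 2 - r ^ 2) + J - Real.pi * (ρ' ^ 2)⁻¹) *
        (1 - (‖b‖ * r ^ 2) ^ 2) ≤
      Real.pi * (2 * D * r + D ^ 2 * r ^ 4 + ‖b‖ ^ 2 * r ^ 2) := by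
    intro ρ' hρρ' hρ' r hr hrr₀ hr2 hbr
    have hnorm : ‖b * (r : ℂ) ^ 2‖ = ‖b‖ * r ^ 2 := by
      rw [norm_mul, norm_pow, Complex.norm_of_nonneg hr.le]
    have hpos : 0 < 1 - (‖b‖ * r ^ 2) ^ 2 := by
      have : 0 ≤ ‖b‖ * r ^ 2 := by positivity
      nlinarith
    have hle := setIntegral_annulus_norm_deriv_sq_le hu hinj hu0 hH huH hr
      (hrr₀.trans (hrρ.trans hρρ')) hρ' (hnorm.trans_lt hbr) (hboundary r hr hr2)
    rw [setIntegral_annulus_norm_neg_inv_sq_add hdH hr (hrr₀.trans (hrρ.trans hρρ')) hρ', ← hb,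
      hnorm, le_div_iff₀ hpos] at hle
    have hJle : J ≤ ∫ z in closedBall 0 ρ' \ ball 0 r, ‖deriv H z - b‖ ^ 2 := by
      refine setIntegral_mono_set (hintegrable r ρ' hρ')
        (Eventually.of_forall fun z ↦ by positivity) ?_
      exact (Set.sdiff_subset_sdiff (closedBall_subset_closedBall hρρ')
        (ball_subset_ball hrr₀)).eventuallyLE
    have hJmul := mul_le_mul_of_nonneg_right hJle hpos.le
    have hexp : Real.pi * (r⁻¹ + D * r ^ 2) ^ 2 -
        Real.pi * (r ^ 2)⁻¹ * (1 - (‖b‖ * r ^ 2) ^ 2) =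
        Real.pi * (2 * D * r + D ^ 2 * r ^ 4 + ‖b‖ ^ 2 * r ^ 2) := by
      field_simp
      ring
    linarith
  have hlim : ∀ ρ' : ℝ, ρ ≤ ρ' → ρ' < 1 →
      Real.pi * ‖b‖ ^ 2 * ρ' ^ 2 + J - Real.pi * (ρ' ^ 2)⁻¹ ≤ 0 := by
    intro ρ' hρρ' hρ'
    have hl : Tendsto (fun r : ℝ ↦ (Real.pi * ‖b‖ ^ 2 * (ρ' ^ 2 - r ^ 2) + J -
        Real.pi * (ρ' ^ 2)⁻¹) * (1 - (‖b‖ * r ^ 2) ^ 2)) (𝓝[>] 0)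
        (𝓝 (Real.pi * ‖b‖ ^ 2 * ρ' ^ 2 + J - Real.pi * (ρ' ^ 2)⁻¹)) := by
      refine (Continuous.tendsto' (by fun_prop) 0 _ (by simp)).mono_left nhdsWithin_le_nhds
    have hr : Tendsto (fun r : ℝ ↦ Real.pi * (2 * D * r + D ^ 2 * r ^ 4 + ‖b‖ ^ 2 * r ^ 2))
        (𝓝[>] 0) (𝓝 0) :=
      (Continuous.tendsto' (by fun_prop) 0 _ (by simp)).mono_left nhdsWithin_le_nhds
    have hsmall : ∀ᶠ r : ℝ in 𝓝[>] 0, ‖b‖ * r ^ 2 < 1 := by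
      have : Tendsto (fun r : ℝ ↦ ‖b‖ * r ^ 2) (𝓝[>] 0) (𝓝 0) :=
        (Continuous.tendsto' (by fun_prop) 0 _ (by simp)).mono_left nhdsWithin_le_nhds
      exact this.eventually_lt_const one_pos
    refine le_of_tendsto_of_tendsto hl hr ?_
    filter_upwards [hsmall, Ioc_mem_nhdsGT hr₀, Ioc_mem_nhdsGT (one_half_pos (α := ℝ))]
      with r h1 h2 h3
    exact hcmp ρ' hρρ' hρ' r h2.1 h2.2 h3.2 h1
  have hl : Tendsto (fun ρ' : ℝ ↦ Real.pi * ‖b‖ ^ 2 * ρ' ^ 2 + J - Real.pi * (ρ' ^ 2)⁻¹) (𝓝[<] 1)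
      (𝓝 (Real.pi * ‖b‖ ^ 2 * 1 ^ 2 + J - Real.pi * (1 ^ 2)⁻¹)) := by
    have hinv : Tendsto (fun ρ' : ℝ ↦ (ρ' ^ 2)⁻¹) (𝓝[<] 1) (𝓝 (1 ^ 2)⁻¹) :=
      ((((continuous_id (X := ℝ)).pow 2).tendsto 1).inv₀ (by simp)).mono_left nhdsWithin_le_nhds
    refine Tendsto.sub (Tendsto.mono_left ?_ nhdsWithin_le_nhds) (hinv.const_mul _)
    exact Continuous.tendsto' (by fun_prop) 1 _ rfl
  have := le_of_tendsto hl (by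
    filter_upwards [Ico_mem_nhdsLT hρ] with ρ' h using hlim ρ' h.1 h.2)
  norm_num at this
  linarith

open MeasureTheory in
/-- **The area theorem**: if `u` is univalent on the unit disc and `1 / u z = 1 / z + H z` with
`H` holomorphic and `H 0 = 0`, then `‖H' 0‖ ≤ 1`; in the equality case `H'` is constant. -/
theorem area_theorem {u H : ℂ → ℂ} (hu : DifferentiableOn ℂ u (ball 0 1))
    (hinj : Set.InjOn u (ball 0 1)) (hu0 : u 0 = 0) (hH : DifferentiableOn ℂ H (ball 0 1))
    (hH0 : H 0 = 0) (huH : ∀ z ∈ ball (0 : ℂ) 1, z ≠ 0 → (u z)⁻¹ = z⁻¹ + H z) :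
    ‖deriv H 0‖ ≤ 1 ∧ (‖deriv H 0‖ = 1 → ∀ z ∈ ball (0 : ℂ) 1, deriv H z = deriv H 0) := by
  have key : ∀ r ρ : ℝ, 0 < r → r ≤ ρ → ρ < 1 → _ := fun r ρ hr hrρ hρ ↦
    area_theorem_annulus hu hinj hu0 hH hH0 huH hr hrρ hρ
  constructor
  · have h := key (1 / 2) (1 / 2) (by norm_num) le_rfl (by norm_num)
    have hJ : 0 ≤ ∫ z in closedBall (0 : ℂ) (1 / 2) \ ball 0 (1 / 2),
        ‖deriv H z - deriv H 0‖ ^ 2 := by positivity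
    have hsq : ‖deriv H 0‖ ^ 2 ≤ 1 := by
      have := Real.pi_pos
      by_contra! hlt
      nlinarith
    exact (sq_le_one_iff₀ (norm_nonneg _)).1 hsq
  · intro hb z hz
    rcases eq_or_ne z 0 with rfl | hz0
    · rfl
    have hz' : ‖z‖ < 1 := mem_ball_zero_iff.1 hz
    obtain ⟨ρ, hzρ, hρ⟩ := exists_between hz'
    have hr : 0 < ‖z‖ / 2 := half_pos (norm_pos_iff.2 hz0)
    have h := key (‖z‖ / 2) ρ hr (by linarith) hρ
    have hcont : ContinuousOn (fun w ↦ ‖deriv H w - deriv H 0‖ ^ 2) (ball 0 1) :=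
      ((hH.deriv isOpen_ball).continuousOn.sub continuousOn_const).norm.pow 2
    have hsub : closedBall (0 : ℂ) ρ \ ball 0 (‖z‖ / 2) ⊆ ball 0 1 :=
      Set.sdiff_subset.trans (closedBall_subset_ball hρ)
    have hopen : IsOpen (ball (0 : ℂ) ρ \ closedBall 0 (‖z‖ / 2)) :=
      isOpen_ball.sdiff isClosed_closedBall
    have hss : ball (0 : ℂ) ρ \ closedBall 0 (‖z‖ / 2) ⊆ closedBall 0 ρ \ ball 0 (‖z‖ / 2) :=
      Set.sdiff_subset_sdiff ball_subset_closedBall ball_subset_closedBall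
    rw [hb] at h
    have hJ : ∫ w in closedBall (0 : ℂ) ρ \ ball 0 (‖z‖ / 2),
        ‖deriv H w - deriv H 0‖ ^ 2 = 0 :=
      le_antisymm (by linarith) (by positivity)
    rw [setIntegral_eq_zero_iff_of_nonneg_ae (Filter.Eventually.of_forall fun w ↦ by positivity)
      ((hcont.mono hsub).integrableOn_compact
        ((isCompact_closedBall 0 ρ).diff isOpen_ball))] at hJ
    have := Measure.eqOn_open_of_ae_eq (ae_restrict_of_ae_restrict_of_subset hss hJ) hopen
      (hcont.mono (hss.trans hsub)) continuousOn_const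
      (show z ∈ ball (0 : ℂ) ρ \ closedBall 0 (‖z‖ / 2) by
        simp [hzρ, norm_pos_iff.2 hz0])
    simpa [sub_eq_zero] using this

/-- A nonvanishing holomorphic function on a disc has a holomorphic square root, normalised at the
centre. -/
theorem DifferentiableOn.exists_sq_eq_of_ne_zero {φ : ℂ → ℂ} {R : ℝ} (hR : 0 < R)
    (hφ : DifferentiableOn ℂ φ (ball 0 R)) (hne : ∀ z ∈ ball (0 : ℂ) R, φ z ≠ 0)
    (hφ0 : φ 0 = 1) :
    ∃ q : ℂ → ℂ, DifferentiableOn ℂ q (ball 0 R) ∧ q 0 = 1 ∧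
      ∀ z ∈ ball (0 : ℂ) R, q z ^ 2 = φ z := by
  obtain ⟨L, hL⟩ := ((hφ.deriv isOpen_ball).div hφ hne).isExactOn_ball
  have h0 : (0 : ℂ) ∈ ball (0 : ℂ) R := mem_ball_self hR
  refine ⟨fun z ↦ Complex.exp ((L z - L 0) / 2), fun z hz ↦ ?_, by simp, fun z hz ↦ ?_⟩
  · exact (((hL z hz).differentiableAt.sub_const _).div_const
      2).cexp.differentiableWithinAt
  · have hder : ∀ z ∈ ball (0 : ℂ) R,
        HasDerivAt (fun z ↦ φ z * Complex.exp (-(L z - L 0))) 0 z := fun z hz ↦ by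
      refine ((hφ.differentiableAt (isOpen_ball.mem_nhds hz)).hasDerivAt.mul
        ((hL z hz).sub_const (L 0)).neg.cexp).congr_deriv ?_
      have := hne z hz
      simp only [Pi.div_apply]
      field_simp
      ring
    have hconst := (convex_ball (0 : ℂ) R).is_const_of_fderivWithin_eq_zero (𝕜 := ℂ)
      (fun z hz ↦ (hder z hz).differentiableAt.differentiableWithinAt)
      (fun z hz ↦ by
        rw [fderivWithin_of_isOpen isOpen_ball hz, (hder z hz).hasFDerivAt.fderiv]
        simp) hz h0
    simp only [sub_self, neg_zero, Complex.exp_zero, mul_one, hφ0, Complex.exp_neg] at hconst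
    rw [← Complex.exp_nat_mul, Nat.cast_two, mul_div_cancel₀ _ two_ne_zero]
    exact (div_eq_one_iff_eq (Complex.exp_ne_zero _)).1 hconst |>.symm

open Filter Topology in
/-- The second derivative at the origin of `z * φ z`. -/
theorem iteratedDeriv_two_of_eventuallyEq_mul {f φ : ℂ → ℂ} (hφ : AnalyticAt ℂ φ 0)
    (hf : ∀ᶠ z in 𝓝 0, f z = z * φ z) : iteratedDeriv 2 f 0 = 2 * deriv φ 0 := by
  have h1 : deriv f =ᶠ[𝓝 0] fun z ↦ φ z + z * deriv φ z := by
    filter_upwards [hf.eventually_nhds, hφ.eventually_analyticAt] with z hz hz'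
    rw [EventuallyEq.deriv_eq hz]
    exact ((hasDerivAt_id z).mul hz'.differentiableAt.hasDerivAt).deriv.trans (by simp)
  rw [iteratedDeriv_succ, iteratedDeriv_one, h1.deriv_eq]
  exact (hφ.differentiableAt.hasDerivAt.add ((hasDerivAt_id (0 : ℂ)).mul
    hφ.deriv.differentiableAt.hasDerivAt)).deriv.trans (by simp; ring)

/-- If `f z = z * q z ^ 2` is injective on the unit disc and `q` does not vanish there, then the
square-root transform `z * q (z ^ 2)` is injective on the disc. -/
theorem injOn_mul_comp_sq {f q : ℂ → ℂ} (hinj : Set.InjOn f (ball 0 1))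
    (hq : ∀ z ∈ ball (0 : ℂ) 1, f z = z * q z ^ 2) (hq0 : ∀ z ∈ ball (0 : ℂ) 1, q z ≠ 0) :
    Set.InjOn (fun z ↦ z * q (z ^ 2)) (ball 0 1) := by
  intro z hz w hw hzw
  have hmem : ∀ x ∈ ball (0 : ℂ) 1, x ^ 2 ∈ ball (0 : ℂ) 1 := fun x hx ↦ by
    rw [mem_ball_zero_iff] at hx ⊢
    rw [norm_pow]
    exact pow_lt_one₀ (norm_nonneg x) hx two_ne_zero
  simp only at hzw
  have hsq : z ^ 2 = w ^ 2 := by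
    refine hinj (hmem z hz) (hmem w hw) ?_
    rw [hq _ (hmem z hz), hq _ (hmem w hw), ← mul_pow, ← mul_pow, hzw]
  rw [hsq] at hzw
  exact mul_right_cancel₀ (hq0 _ (hmem w hw)) hzw

open Filter Topology in
/-- Coefficient bound for `f z = z * φ z` in the class `S`, with the equality case. -/
theorem norm_deriv_le_two_of_injOn_mul {f φ : ℂ → ℂ} (hinj : Set.InjOn f (ball 0 1))
    (hφ : DifferentiableOn ℂ φ (ball 0 1)) (hfφ : ∀ z, f z = z * φ z) (hφ0 : φ 0 = 1) :
    ‖deriv φ 0‖ ≤ 2 ∧ (‖deriv φ 0‖ = 2 →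
      ∀ z ∈ ball (0 : ℂ) 1, f z = z / (1 - deriv φ 0 / 2 * z) ^ 2) := by
  have h0 : (0 : ℂ) ∈ ball (0 : ℂ) 1 := by simp
  have hnhds : ball (0 : ℂ) 1 ∈ 𝓝 0 := ball_mem_nhds 0 one_pos
  have hφne : ∀ z ∈ ball (0 : ℂ) 1, φ z ≠ 0 := by
    intro z hz h
    have : z = 0 := hinj hz h0 (by simp [hfφ, h])
    rw [this, hφ0] at h
    exact one_ne_zero h
  obtain ⟨q, hqd, hq0, hq⟩ := hφ.exists_sq_eq_of_ne_zero one_pos hφne hφ0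
  have hqne : ∀ z ∈ ball (0 : ℂ) 1, q z ≠ 0 := fun z hz h ↦
    hφne z hz (by rw [← hq z hz, h]; simp)
  have hmem : Set.MapsTo (fun x : ℂ ↦ x ^ 2) (ball 0 1) (ball 0 1) := fun x hx ↦ by
    rw [mem_ball_zero_iff] at hx ⊢
    rw [norm_pow]
    exact pow_lt_one₀ (norm_nonneg x) hx two_ne_zero
  have hpd : DifferentiableOn ℂ (fun z ↦ (q z)⁻¹) (ball 0 1) := hqd.inv hqne
  set P := dslope (fun z ↦ (q z)⁻¹) 0 with hP
  have hPd : DifferentiableOn ℂ P (ball 0 1) := (Complex.differentiableOn_dslope hnhds).2 hpd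
  have hPq : ∀ z, z * P z = (q z)⁻¹ - 1 := fun z ↦ by
    simpa [hq0] using sub_smul_dslope (fun z ↦ (q z)⁻¹) 0 z
  have hP2 : DifferentiableOn ℂ (fun z ↦ P (z ^ 2)) (ball 0 1) :=
    hPd.comp (by fun_prop) hmem
  have hq2 : DifferentiableOn ℂ (fun z ↦ q (z ^ 2)) (ball 0 1) :=
    hqd.comp (by fun_prop) hmem
  have hder : deriv φ 0 = -2 * P 0 := by
    have hq' := (hqd.differentiableAt hnhds).hasDerivAt
    have h1 : deriv φ 0 = 2 * deriv q 0 := by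
      rw [EventuallyEq.deriv_eq (f := fun z ↦ q z ^ 2)
        (eventually_of_mem hnhds fun z hz ↦ (hq z hz).symm), (hq'.fun_pow 2).deriv, hq0]
      simp
    have h2 : P 0 = -deriv q 0 := by
      rw [hP, dslope_same, (hq'.fun_inv (hqne 0 h0)).deriv, hq0]
      simp
    rw [h1, h2]
    ring
  have hHder : deriv (fun z ↦ z * P (z ^ 2)) 0 = P 0 := by
    have := (hasDerivAt_id (0 : ℂ)).mul (hP2.differentiableAt hnhds).hasDerivAt
    exact this.deriv.trans (by simp)
  obtain ⟨hle, heq⟩ := area_theorem (u := fun z ↦ z * q (z ^ 2)) (H := fun z ↦ z * P (z ^ 2))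
    (differentiableOn_id.mul hq2)
    (injOn_mul_comp_sq hinj (fun z hz ↦ by rw [hfφ, hq z hz]) hqne) (by simp)
    (differentiableOn_id.mul hP2) (by simp) (fun z hz hz0 ↦ by
      have := hPq (z ^ 2)
      rw [mul_inv, eq_add_of_sub_eq this.symm]
      field_simp
      ring)
  rw [hHder] at hle heq
  have hnorm : ‖deriv φ 0‖ = 2 * ‖P 0‖ := by rw [hder]; simp
  refine ⟨by linarith, fun h2 ↦ ?_⟩
  have hconst := heq (by linarith)
  have hlin : ∀ z ∈ ball (0 : ℂ) 1, z * P (z ^ 2) - P 0 * z = 0 := by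
    intro z hz
    have hd : ∀ z ∈ ball (0 : ℂ) 1, HasDerivAt (fun z ↦ z * P (z ^ 2) - P 0 * z) 0 z :=
      fun z hz ↦ by
        refine (((differentiableOn_id.mul hP2).differentiableAt
          (isOpen_ball.mem_nhds hz)).hasDerivAt.sub
            ((hasDerivAt_id z).const_mul (P 0))).congr_deriv ?_
        rw [mul_one, sub_eq_zero]
        exact hconst z hz
    have := (convex_ball (0 : ℂ) 1).is_const_of_fderivWithin_eq_zero (𝕜 := ℂ)
      (fun z hz ↦ (hd z hz).differentiableAt.differentiableWithinAt)
      (fun z hz ↦ by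
        rw [fderivWithin_of_isOpen isOpen_ball hz, (hd z hz).hasFDerivAt.fderiv]
        simp) hz h0
    simpa using this
  intro z hz
  rcases eq_or_ne z 0 with rfl | hz0
  · simp [hfφ]
  obtain ⟨ζ, rfl⟩ : ∃ ζ, z = ζ ^ 2 := ⟨_, (Complex.cpow_nat_inv_pow z two_ne_zero).symm⟩
  have hζ0 : ζ ≠ 0 := by
    rintro rfl
    simp at hz0
  have hζ : ζ ∈ ball (0 : ℂ) 1 := by
    rw [mem_ball_zero_iff] at hz ⊢
    rw [norm_pow] at hz
    exact lt_of_pow_lt_pow_left₀ 2 zero_le_one (by simpa using hz)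
  have hPζ : P (ζ ^ 2) = P 0 := by
    refine mul_left_cancel₀ hζ0 ?_
    linear_combination hlin ζ hζ
  have hinv := hPq (ζ ^ 2)
  rw [hPζ] at hinv
  rw [hfφ, ← hq _ hz, hder, show 1 - -2 * P 0 / 2 * ζ ^ 2 = (q (ζ ^ 2))⁻¹ by
    linear_combination hinv]
  simp

/-- **Bieberbach's theorem.** For `f` in the class `S`, `|a₂| ≤ 2`, with equality iff
`f` is a rotation of the Koebe function `k z = z / (1 - z)^2`. -/
theorem bieberbach_second_coefficient (f : ℂ → ℂ)
    (hf : DifferentiableOn ℂ f (ball (0 : ℂ) 1))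
    (hinj : Set.InjOn f (ball (0 : ℂ) 1))
    (hf0 : f 0 = 0) (hf1 : deriv f 0 = 1)
    (a : ℕ → ℂ) (ha : ∀ n, a n = iteratedDeriv n f 0 / (n.factorial : ℂ)) :
    ‖a 2‖ ≤ 2 ∧
      (‖a 2‖ = 2 ↔ ∃ θ : ℝ, ∀ z ∈ ball (0 : ℂ) 1,
        f z = Complex.exp (-(θ * Complex.I)) *
          ((Complex.exp (θ * Complex.I) * z) /
            (1 - Complex.exp (θ * Complex.I) * z) ^ 2)) := by
  have hnhds : ball (0 : ℂ) 1 ∈ nhds 0 := ball_mem_nhds 0 one_pos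
  have hφ : DifferentiableOn ℂ (dslope f 0) (ball 0 1) :=
    (Complex.differentiableOn_dslope hnhds).2 hf
  have hfφ : ∀ z, f z = z * dslope f 0 z := fun z ↦ by
    simpa [hf0] using (sub_smul_dslope f 0 z).symm
  have ha2 : a 2 = deriv (dslope f 0) 0 := by
    rw [ha, iteratedDeriv_two_of_eventuallyEq_mul (hφ.analyticAt hnhds) (.of_forall hfφ)]
    simp
  obtain ⟨hle, heq⟩ := norm_deriv_le_two_of_injOn_mul hinj hφ hfφ (by simp [hf1])
  rw [← ha2] at hle heq
  have hrot : ∀ (θ : ℝ) (z : ℂ), Complex.exp (-(θ * Complex.I)) *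
      ((Complex.exp (θ * Complex.I) * z) / (1 - Complex.exp (θ * Complex.I) * z) ^ 2) =
      z * ((1 - Complex.exp (θ * Complex.I) * z) ^ 2)⁻¹ := fun θ z ↦ by
    rw [Complex.exp_neg, mul_div_assoc, inv_mul_cancel_left₀ (Complex.exp_ne_zero _),
      div_eq_mul_inv]
  refine ⟨hle, fun h ↦ ⟨(a 2).arg, fun z hz ↦ ?_⟩, ?_⟩
  · have harg : Complex.exp ((a 2).arg * Complex.I) = a 2 / 2 := by
      have := Complex.norm_mul_exp_arg_mul_I (a 2)
      rw [h] at this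
      push_cast at this
      linear_combination this / 2
    rw [hrot, heq h z hz, harg, div_eq_mul_inv]
  · rintro ⟨θ, hθ⟩
    set e := Complex.exp (θ * Complex.I) with he
    have hd : HasDerivAt (fun z : ℂ ↦ ((1 - e * z) ^ 2)⁻¹) (2 * e) 0 := by
      have h1 : HasDerivAt (fun z : ℂ ↦ 1 - e * z) (-e) 0 := by
        simpa using ((hasDerivAt_id (0 : ℂ)).const_mul e).const_sub 1
      refine ((h1.fun_pow 2).fun_inv (by simp)).congr_deriv (by simp)
    have han : AnalyticAt ℂ (fun z : ℂ ↦ ((1 - e * z) ^ 2)⁻¹) 0 :=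
      AnalyticAt.inv (by fun_prop) (by simp)
    rw [ha, iteratedDeriv_two_of_eventuallyEq_mul han
      (Filter.eventually_of_mem hnhds fun z hz ↦ (hθ z hz).trans (hrot θ z)), hd.deriv]
    simp [he, Complex.norm_exp_ofReal_mul_I]
end

section
/- Let f belong to the class S. Then the image f(𝔻) of the open unit disc contains the open disc {w ∈ ℂ : |w| < 1/4}. -/
open Metric
open MeasureTheory Set

/-- Change of variables for an injective holomorphic map. -/
theorem lintegral_image_eq_lintegral_norm_deriv_sq_mul {s : Set ℂ} {f f' : ℂ → ℂ}
    (hs : MeasurableSet s) (hf : ∀ z ∈ s, HasDerivAt f (f' z) z) (hinj : InjOn f s)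
    (g : ℂ → ENNReal) :
    ∫⁻ w in f '' s, g w = ∫⁻ z in s, ENNReal.ofReal (‖f' z‖ ^ 2) * g (f z) := by
  have hdet (c : ℂ) : |(c • (1 : ℂ →L[ℝ] ℂ)).det| = ‖c‖ ^ 2 := by
    have h : ((c • (1 : ℂ →L[ℝ] ℂ) : ℂ →L[ℝ] ℂ) : ℂ →ₗ[ℝ] ℂ) = Algebra.lmul ℝ ℂ c := by
      ext
      all_goals simp
    rw [ContinuousLinearMap.det, h, ← Algebra.norm_apply, Algebra.norm_complex_apply,
      Complex.normSq_eq_norm_sq, abs_of_nonneg (by positivity)]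
  rw [lintegral_image_eq_lintegral_abs_det_fderiv_mul volume hs
    (fun z hz ↦ (hf z hz).complexToReal_fderiv.hasFDerivWithinAt) hinj]
  simp_rw [hdet]

/-- Integration over an annulus against `‖z‖⁻²` in polar coordinates. -/
theorem lintegral_annulus_inv_norm_sq_mul {r R : ℝ} (hr : 0 ≤ r) {h : ℂ → ENNReal}
    (hh : Measurable h) :
    ∫⁻ z in ball 0 R \ closedBall 0 r, ENNReal.ofReal (‖z‖ ^ 2)⁻¹ * h z =
      ∫⁻ s in Ioo r R, ENNReal.ofReal s⁻¹ *
        ∫⁻ θ in Ioo (-Real.pi) Real.pi, h (circleMap 0 s θ) := by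
  have hA : MeasurableSet (ball (0 : ℂ) R \ closedBall 0 r) :=
    measurableSet_ball.diff measurableSet_closedBall
  have hsymm (p : ℝ × ℝ) : Complex.polarCoord.symm p = circleMap 0 p.1 p.2 := by
    simp [circleMap, Complex.exp_mul_I]
  have hsub : Ioo r R ⊆ Ioi 0 := fun s hs ↦ hr.trans_lt hs.1
  rw [← lintegral_indicator hA, ← Complex.lintegral_comp_polarCoord_symm,
    show polarCoord.target = _ from rfl]
  calc
    _ = ∫⁻ p in Ioi (0 : ℝ) ×ˢ Ioo (-Real.pi) Real.pi,
        (Ioo r R ×ˢ univ).indicator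
          (fun p : ℝ × ℝ ↦ ENNReal.ofReal p.1⁻¹ * h (circleMap 0 p.1 p.2)) p := by
      refine setLIntegral_congr_fun (measurableSet_Ioi.prod measurableSet_Ioo) fun p hp ↦ ?_
      have hp0 : 0 < p.1 := hp.1
      simp only [hsymm, indicator, mem_sdiff, mem_ball_zero_iff, mem_closedBall_zero_iff,
        norm_circleMap_zero, abs_of_pos hp0, not_le, mem_prod, mem_Ioo, mem_univ, and_true,
        and_comm (a := p.1 < R)]
      split_ifs
      · rw [smul_eq_mul, ← mul_assoc, ← ENNReal.ofReal_mul hp0.le]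
        congr 2
        field_simp
      · simp
    _ = ∫⁻ p in Ioo r R ×ˢ Ioo (-Real.pi) Real.pi,
        ENNReal.ofReal p.1⁻¹ * h (circleMap 0 p.1 p.2) := by
      rw [setLIntegral_indicator (measurableSet_Ioo.prod .univ), prod_inter_prod, univ_inter,
        inter_eq_left.2 hsub]
    _ = _ := by
      have hc : Measurable fun p : ℝ × ℝ ↦ circleMap 0 p.1 p.2 := by
        unfold circleMap
        fun_prop
      rw [Measure.volume_eq_prod, setLIntegral_prod]
      · refine lintegral_congr fun s ↦
          lintegral_const_mul (ENNReal.ofReal s⁻¹) (f := fun θ ↦ h (circleMap 0 s θ)) ?_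
        exact hh.comp (hc.comp measurable_prodMk_left)
      · fun_prop

theorem lintegral_annulus_inv_norm_sq {r R : ℝ} (hr : 0 < r) (hrR : r ≤ R) :
    ∫⁻ z : ℂ in ball 0 R \ closedBall 0 r, ENNReal.ofReal (‖z‖ ^ 2)⁻¹ =
      ENNReal.ofReal (2 * Real.pi * Real.log (R / r)) := by
  have hpos : ∀ s ∈ Ioc r R, 0 < s := fun s hs ↦ hr.trans hs.1
  have hint : IntervalIntegrable (fun s : ℝ ↦ s⁻¹) volume r R :=
    intervalIntegral.intervalIntegrable_inv (fun s hs ↦ by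
      rw [uIcc_of_le hrR] at hs
      exact (hr.trans_le hs.1).ne') continuousOn_id
  have hlog : ∫⁻ s in Ioo r R, ENNReal.ofReal s⁻¹ = ENNReal.ofReal (Real.log (R / r)) := by
    rw [← integral_inv_of_pos hr (hr.trans_le hrR), intervalIntegral.integral_of_le hrR,
      setLIntegral_congr Ioo_ae_eq_Ioc]
    refine (ofReal_integral_eq_lintegral_ofReal hint.1 ?_).symm
    filter_upwards [ae_restrict_mem measurableSet_Ioc] with s hs
    exact inv_nonneg.2 (hpos s hs).le
  have := lintegral_annulus_inv_norm_sq_mul (R := R) hr.le (h := fun _ ↦ 1) measurable_const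
  simp only [mul_one, lintegral_const, Measure.restrict_apply_univ, Real.volume_Ioo, one_mul,
    sub_neg_eq_add] at this
  rw [this, lintegral_mul_const _ (by fun_prop), hlog, mul_comm,
    ← ENNReal.ofReal_mul (by positivity), ← two_mul]

/-- The mean value inequality `‖v 0‖ ≤ mean of ‖v‖` on circles centred at `0`, integrated over an
annulus against `‖z‖⁻²`. -/
theorem lintegral_annulus_inv_norm_sq_le {v : ℂ → ℂ} (hv : DifferentiableOn ℂ v (ball 0 1))
    (hv0 : ‖v 0‖ₑ = 1) {r R : ℝ} (hr : 0 ≤ r) (hR : R ≤ 1) :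
    ∫⁻ z : ℂ in ball 0 R \ closedBall 0 r, ENNReal.ofReal (‖z‖ ^ 2)⁻¹ ≤
      ∫⁻ z in ball 0 R \ closedBall 0 r, ENNReal.ofReal (‖z‖ ^ 2)⁻¹ * ‖v z‖ₑ := by
  classical
  set k := (ball (0 : ℂ) 1).piecewise v 0
  have hk : Measurable k :=
    hv.continuousOn.measurable_piecewise continuousOn_const measurableSet_ball
  have hkv : ∀ z ∈ ball (0 : ℂ) 1, k z = v z := fun z hz ↦ piecewise_eq_of_mem _ _ _ hz
  have hA : MeasurableSet (ball (0 : ℂ) R \ closedBall 0 r) :=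
    measurableSet_ball.diff measurableSet_closedBall
  have hright : ∫⁻ z in ball 0 R \ closedBall 0 r, ENNReal.ofReal (‖z‖ ^ 2)⁻¹ * ‖v z‖ₑ =
      ∫⁻ z in ball 0 R \ closedBall 0 r, ENNReal.ofReal (‖z‖ ^ 2)⁻¹ * ‖k z‖ₑ :=
    setLIntegral_congr_fun hA fun z hz ↦ by
      simp only [hkv z (ball_subset_ball hR hz.1)]
  have hleft := lintegral_annulus_inv_norm_sq_mul (R := R) hr (h := fun _ ↦ 1) measurable_const
  simp only [mul_one] at hleft
  rw [hright, hleft, lintegral_annulus_inv_norm_sq_mul hr hk.enorm]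
  refine setLIntegral_mono' measurableSet_Ioo fun s hs ↦ mul_le_mul_right ?_ _
  have hs0 : 0 < s := hr.trans_lt hs.1
  have hs1 : s < 1 := hs.2.trans_le hR
  have hmean : ∫ θ in Ioo (-Real.pi) Real.pi, k (circleMap 0 s θ) = (2 * Real.pi) • v 0 := by
    have hd : DiffContOnCl ℂ v (ball 0 |s|) := by
      rw [abs_of_pos hs0]
      exact (hv.mono (closedBall_subset_ball hs1)).diffContOnCl_ball Subset.rfl
    rw [← hd.circleAverage, Real.circleAverage_def, smul_smul,
      mul_inv_cancel₀ (by positivity), one_smul]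
    have hper : (fun θ ↦ v (circleMap 0 s θ)).Periodic (2 * Real.pi) := fun θ ↦ by
      simp [periodic_circleMap 0 s θ]
    have := hper.intervalIntegral_add_eq 0 (-Real.pi)
    rw [zero_add, show -Real.pi + 2 * Real.pi = Real.pi by ring] at this
    rw [this, intervalIntegral.integral_of_le (by linarith [Real.pi_pos]),
      integral_Ioc_eq_integral_Ioo]
    refine setIntegral_congr_fun measurableSet_Ioo fun θ _ ↦ hkv _ ?_
    simpa [abs_of_pos hs0] using hs1
  calc
    ∫⁻ _ in Ioo (-Real.pi) Real.pi, 1 = ‖(2 * Real.pi) • v 0‖ₑ := by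
      rw [enorm_smul, hv0, setLIntegral_one, Real.volume_Ioo,
        Real.enorm_of_nonneg (by positivity), mul_one]
      congr 1
      ring
    _ ≤ _ := by
      rw [← hmean]
      exact enorm_integral_le_lintegral_enorm _

/-- Away from the line through `0` and `w`, the Koebe function `z ↦ -4wz / (1 - z)²` has a
preimage in the unit disc, with an explicit lower bound on its norm. -/
theorem exists_koebe_eq {w ζ : ℂ} {m : ℝ} (hw : w ≠ 0) (hm : 0 < m) (hζ : m < ‖ζ‖)
    (hline : ζ ∉ Submodule.span ℝ {w}) :
    ∃ z ∈ ball (0 : ℂ) 1 \ closedBall 0 (4 * ‖w‖ / m + 3)⁻¹, -4 * w * z / (1 - z) ^ 2 = ζ := by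
  have hζ0 : ζ ≠ 0 := norm_pos_iff.1 (hm.trans hζ)
  obtain ⟨d, hd⟩ := IsAlgClosed.exists_pow_nat_eq ((-4 * w / ζ + 2) ^ 2 - 4) two_pos
  have hprod : ((-4 * w / ζ + 2 + d) / 2) * ((-4 * w / ζ + 2 - d) / 2) = 1 := by
    linear_combination -hd / 4
  have hroot : ∃ z : ℂ, z ≠ 0 ∧ z + z⁻¹ = -4 * w / ζ + 2 := by
    refine ⟨_, left_ne_zero_of_mul_eq_one hprod, ?_⟩
    rw [inv_eq_of_mul_eq_one_right hprod]
    ring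
  have hne : ∀ z : ℂ, z + z⁻¹ = -4 * w / ζ + 2 → ‖z‖ ≠ 1 := by
    intro z hz h1
    rw [Complex.inv_eq_conj h1, Complex.add_conj] at hz
    have hz2 : ((2 * z.re - 2 : ℝ) : ℂ) = -4 * w / ζ := by
      push_cast at hz ⊢
      linear_combination hz
    have ht : ((2 * z.re - 2 : ℝ) : ℂ) ≠ 0 := by
      rw [hz2]
      exact div_ne_zero (mul_ne_zero (by norm_num) hw) hζ0
    refine hline (Submodule.mem_span_singleton.2 ⟨-4 / (2 * z.re - 2), ?_⟩)
    rw [Complex.real_smul, Complex.ofReal_div, div_mul_eq_mul_div, div_eq_iff ht, hz2]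
    push_cast
    field_simp
  obtain ⟨z, hz0, hz1, hz⟩ : ∃ z : ℂ, z ≠ 0 ∧ ‖z‖ < 1 ∧ z + z⁻¹ = -4 * w / ζ + 2 := by
    obtain ⟨z, hz0, hz⟩ := hroot
    rcases (hne z hz).lt_or_gt with h | h
    · exact ⟨z, hz0, h, hz⟩
    · refine ⟨z⁻¹, inv_ne_zero hz0, ?_, by rw [inv_inv, add_comm, hz]⟩
      rw [norm_inv]
      exact inv_lt_one_of_one_lt₀ h
  have hz1' : 1 - z ≠ 0 := sub_ne_zero.2 fun h ↦ by simp [← h] at hz1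
  refine ⟨z, ⟨by simpa using hz1, ?_⟩, ?_⟩
  · have hbound : ‖z‖⁻¹ < 4 * ‖w‖ / m + 3 := by
      calc
        ‖z‖⁻¹ = ‖-4 * w / ζ + 2 - z‖ := by rw [← hz, add_sub_cancel_left, norm_inv]
        _ ≤ ‖-4 * w / ζ‖ + ‖(2 : ℂ)‖ + ‖z‖ :=
          (norm_sub_le _ _).trans (by gcongr; exact norm_add_le _ _)
        _ = 4 * ‖w‖ / ‖ζ‖ + 2 + ‖z‖ := by simp
        _ < 4 * ‖w‖ / m + 3 := by
          have : 4 * ‖w‖ / ‖ζ‖ ≤ 4 * ‖w‖ / m := by gcongr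
          linarith
    rw [mem_closedBall_zero_iff, not_le]
    exact inv_lt_of_inv_lt₀ (norm_pos_iff.2 hz0) hbound
  · rw [div_eq_iff (pow_ne_zero 2 hz1')]
    field_simp at hz
    linear_combination -hz

theorem injOn_koebe {w : ℂ} (hw : w ≠ 0) :
    InjOn (fun z : ℂ ↦ -4 * w * z / (1 - z) ^ 2) (ball 0 1) := by
  intro x hx y hy hxy
  rw [mem_ball_zero_iff] at hx hy
  have hx1 : 1 - x ≠ 0 := sub_ne_zero.2 fun h ↦ by simp [← h] at hx
  have hy1 : 1 - y ≠ 0 := sub_ne_zero.2 fun h ↦ by simp [← h] at hy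
  have hxy1 : 1 - x * y ≠ 0 := sub_ne_zero.2 fun h ↦ by
    have := mul_lt_one_of_nonneg_of_lt_one_left (norm_nonneg x) hx hy.le
    simp [← norm_mul, ← h] at this
  simp only at hxy
  rw [div_eq_div_iff (pow_ne_zero 2 hx1) (pow_ne_zero 2 hy1)] at hxy
  have : (4 * w) * ((1 - x * y) * (x - y)) = 0 := by linear_combination -hxy
  simpa [hw, hxy1, sub_eq_zero] using this

/-- The weighted area of `{‖ζ‖ > m}`, bounded by pulling back along the Koebe function. -/
theorem lintegral_norm_gt_le {w : ℂ} (hw : w ≠ 0) {m : ℝ} (hm : 0 < m) :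
    ∫⁻ ζ in {ζ : ℂ | m < ‖ζ‖}, ENNReal.ofReal (‖w‖ / (‖ζ‖ ^ 2 * ‖ζ - w‖)) ≤
      ENNReal.ofReal (2 * Real.pi * Real.log (4 * ‖w‖ / m + 3)) := by
  have hT : 1 ≤ 4 * ‖w‖ / m + 3 := by
    have : 0 ≤ 4 * ‖w‖ / m := by positivity
    linarith
  set a := (4 * ‖w‖ / m + 3)⁻¹ with ha
  have ha0 : 0 < a := by positivity
  have hA : MeasurableSet (ball (0 : ℂ) 1 \ closedBall 0 a) :=
    measurableSet_ball.diff measurableSet_closedBall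
  have hnull : volume (Submodule.span ℝ {w} : Set ℂ) = 0 := by
    refine Measure.addHaar_submodule _ _ fun h ↦ ?_
    have := finrank_span_singleton (K := ℝ) hw
    rw [h, finrank_top, Complex.finrank_real_complex] at this
    norm_num at this
  have hne1 : ∀ z ∈ ball (0 : ℂ) 1, 1 - z ≠ 0 ∧ 1 + z ≠ 0 := by
    intro z hz
    rw [mem_ball_zero_iff] at hz
    exact ⟨sub_ne_zero.2 fun h ↦ by simp [← h] at hz,
      fun h ↦ by simp [eq_neg_of_add_eq_zero_right h] at hz⟩
  have hsub : ({ζ : ℂ | m < ‖ζ‖} : Set ℂ) ≤ᵐ[volume]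
      (fun z ↦ -4 * w * z / (1 - z) ^ 2) '' (ball 0 1 \ closedBall 0 a) := by
    filter_upwards [measure_eq_zero_iff_ae_notMem.1 hnull] with ζ hζ hmζ
    exact exists_koebe_eq hw hm hmζ hζ
  refine (lintegral_mono' (Measure.restrict_mono' hsub le_rfl) le_rfl).trans ?_
  rw [lintegral_image_eq_lintegral_norm_deriv_sq_mul
    (f' := fun z ↦ -4 * w * (1 + z) / (1 - z) ^ 3) hA _ ((injOn_koebe hw).mono sdiff_subset)]
  · have := lintegral_annulus_inv_norm_sq ha0 (inv_le_one_of_one_le₀ hT)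
    rw [one_div, ha, inv_inv, ← ha] at this
    rw [← this]
    refine (setLIntegral_congr_fun hA fun z hz ↦ ?_).le
    obtain ⟨h1, h2⟩ := hne1 z hz.1
    have hz0 : z ≠ 0 := by
      rintro rfl
      exact hz.2 (mem_closedBall_self ha0.le)
    have hsubw : -4 * w * z / (1 - z) ^ 2 - w = -w * (1 + z) ^ 2 / (1 - z) ^ 2 := by
      field_simp
      ring
    rw [hsubw, ← ENNReal.ofReal_mul (by positivity)]
    congr 1
    have := norm_ne_zero_iff.2 h1
    have := norm_ne_zero_iff.2 h2
    have := norm_ne_zero_iff.2 hz0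
    have := norm_ne_zero_iff.2 hw
    simp only [norm_div, norm_mul, norm_pow, norm_neg, Complex.norm_ofNat]
    field_simp
  · intro z hz
    obtain ⟨h1, -⟩ := hne1 z hz.1
    have hden : HasDerivAt (fun z : ℂ ↦ (1 - z) ^ 2) (2 * (1 - z) * -1) z := by
      simpa using ((hasDerivAt_id z).const_sub 1).fun_pow 2
    refine (((hasDerivAt_id z).const_mul (-4 * w)).fun_div hden (pow_ne_zero 2 h1)).congr_deriv ?_
    simp only [id]
    field_simp
    ring

/-- `dslope f 0` is the function `f z / z`, extended by `f' 0` to `z = 0`. -/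
theorem mul_dslope_zero {f : ℂ → ℂ} (hf0 : f 0 = 0) (z : ℂ) : z * dslope f 0 z = f z := by
  simpa [hf0] using sub_smul_dslope f 0 z

theorem dslope_zero_ne_zero {f : ℂ → ℂ} (hinj : InjOn f (ball 0 1)) (hf0 : f 0 = 0)
    (hf1 : deriv f 0 = 1) {z : ℂ} (hz : z ∈ ball (0 : ℂ) 1) : dslope f 0 z ≠ 0 := by
  intro h
  rcases eq_or_ne z 0 with rfl | hz0
  · simp [hf1] at h
  · refine hz0 (hinj hz (mem_ball_self one_pos) ?_)
    rw [← mul_dslope_zero hf0 z, h, mul_zero, hf0]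

/-- Since `1 / f z - 1 / z` is bounded near `0`, the values `f z` with `r < ‖z‖` satisfy
`‖f z‖ > (r⁻¹ + C)⁻¹` with `C` independent of `r`. -/
theorem exists_lt_norm_of_injOn {f : ℂ → ℂ} (hf : DifferentiableOn ℂ f (ball 0 1))
    (hinj : InjOn f (ball 0 1)) (hf0 : f 0 = 0) (hf1 : deriv f 0 = 1) {ρ : ℝ} (hρ : ρ < 1) :
    ∃ C : ℝ, 0 ≤ C ∧ ∀ r > 0, ∀ z ∈ ball (0 : ℂ) ρ \ closedBall 0 r, (r⁻¹ + C)⁻¹ < ‖f z‖ := by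
  have hnhds : ball (0 : ℂ) 1 ∈ nhds 0 := ball_mem_nhds 0 one_pos
  have hu : DifferentiableOn ℂ (fun z ↦ (dslope f 0 z)⁻¹) (ball 0 1) :=
    ((Complex.differentiableOn_dslope hnhds).2 hf).inv
      fun z hz ↦ dslope_zero_ne_zero hinj hf0 hf1 hz
  have hd := ((Complex.differentiableOn_dslope hnhds).2 hu).continuousOn.mono
    (closedBall_subset_ball hρ)
  obtain ⟨C, hC⟩ := (isCompact_closedBall (0 : ℂ) ρ).exists_bound_of_continuousOn hd
  refine ⟨max C 0, le_max_right _ _, fun r hr z ⟨hzρ, hzr⟩ ↦ ?_⟩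
  rw [mem_closedBall_zero_iff, not_le] at hzr
  have hz0 : z ≠ 0 := norm_pos_iff.1 (hr.trans hzr)
  have hz1 : z ∈ ball (0 : ℂ) 1 := ball_subset_ball hρ.le hzρ
  have hfz : f z ≠ 0 := by
    rw [← mul_dslope_zero hf0 z]
    exact mul_ne_zero hz0 (dslope_zero_ne_zero hinj hf0 hf1 hz1)
  have hinv : (f z)⁻¹ = z⁻¹ + dslope (fun z ↦ (dslope f 0 z)⁻¹) 0 z := by
    have h := sub_smul_dslope (fun z ↦ (dslope f 0 z)⁻¹) 0 z
    simp only [sub_zero, smul_eq_mul, dslope_same, hf1, inv_one] at h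
    rw [← mul_dslope_zero hf0 z, mul_inv, eq_add_of_sub_eq h.symm, mul_add, mul_one,
      inv_mul_cancel_left₀ hz0, add_comm]
  refine inv_lt_of_inv_lt₀ (norm_pos_iff.2 hfz) ?_
  calc
    ‖f z‖⁻¹ ≤ ‖z‖⁻¹ + ‖dslope (fun z ↦ (dslope f 0 z)⁻¹) 0 z‖ := by
      rw [← norm_inv, hinv, ← norm_inv]
      exact norm_add_le _ _
    _ < r⁻¹ + max C 0 :=
      add_lt_add_of_lt_of_le (inv_strictAnti₀ hr hzr)
        ((hC z (ball_subset_closedBall hzρ)).trans (le_max_left _ _))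

/-- A lower bound for the weighted area of the image of an annulus under a normalised univalent
function omitting `w`. -/
theorem lintegral_annulus_inv_norm_sq_le_lintegral_image {f : ℂ → ℂ}
    (hf : DifferentiableOn ℂ f (ball 0 1)) (hinj : InjOn f (ball 0 1)) (hf0 : f 0 = 0)
    (hf1 : deriv f 0 = 1) {w : ℂ} (hw : w ∉ f '' ball 0 1) {r ρ : ℝ} (hr : 0 ≤ r) (hρ : ρ ≤ 1) :
    ∫⁻ z : ℂ in ball 0 ρ \ closedBall 0 r, ENNReal.ofReal (‖z‖ ^ 2)⁻¹ ≤
      ∫⁻ ζ in f '' (ball 0 ρ \ closedBall 0 r),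
        ENNReal.ofReal (‖w‖ / (‖ζ‖ ^ 2 * ‖ζ - w‖)) := by
  have hsub : ball (0 : ℂ) ρ \ closedBall 0 r ⊆ ball 0 1 :=
    sdiff_subset.trans (ball_subset_ball hρ)
  have hA : MeasurableSet (ball (0 : ℂ) ρ \ closedBall 0 r) :=
    measurableSet_ball.diff measurableSet_closedBall
  have hw0 : w ≠ 0 := fun h ↦ hw ⟨0, mem_ball_self one_pos, by rw [hf0, h]⟩
  have hfw : ∀ z ∈ ball (0 : ℂ) 1, f z - w ≠ 0 := fun z hz h ↦ hw ⟨z, hz, sub_eq_zero.1 h⟩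
  have hu : DifferentiableOn ℂ (dslope f 0) (ball 0 1) :=
    (Complex.differentiableOn_dslope (ball_mem_nhds 0 one_pos)).2 hf
  have hv : DifferentiableOn ℂ (fun z ↦ w * deriv f z ^ 2 / (dslope f 0 z ^ 2 * (f z - w)))
      (ball 0 1) :=
    (((hf.deriv isOpen_ball).fun_pow 2).const_mul w).fun_div
      ((hu.fun_pow 2).fun_mul (hf.sub_const w))
      fun z hz ↦ mul_ne_zero (pow_ne_zero 2 (dslope_zero_ne_zero hinj hf0 hf1 hz)) (hfw z hz)
  rw [lintegral_image_eq_lintegral_norm_deriv_sq_mul hA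
    (fun z hz ↦ (hf.differentiableAt (isOpen_ball.mem_nhds (hsub hz))).hasDerivAt)
    (hinj.mono hsub)]
  refine (lintegral_annulus_inv_norm_sq_le hv ?_ hr hρ).trans
    (setLIntegral_congr_fun hA fun z hz ↦ ?_).le
  · rw [← ofReal_norm]
    simp [hf0, hf1, hw0]
  · rw [← ofReal_norm, ← ENNReal.ofReal_mul (by positivity),
      ← ENNReal.ofReal_mul (by positivity), ← mul_dslope_zero hf0 z]
    simp only [norm_div, norm_mul, norm_pow]
    congr 1
    ring

/-- **Koebe one-quarter theorem.** For `f` in the class `S`, the image of the unit disc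
contains the disc of radius `1/4`. -/
theorem koebe_quarter_theorem (f : ℂ → ℂ)
    (hf : DifferentiableOn ℂ f (ball (0 : ℂ) 1))
    (hinj : Set.InjOn f (ball (0 : ℂ) 1))
    (hf0 : f 0 = 0) (hf1 : deriv f 0 = 1) :
    ball (0 : ℂ) (1 / 4) ⊆ f '' ball (0 : ℂ) 1 := by
  intro w hw4
  by_contra hw
  have hw0 : w ≠ 0 := fun h ↦ hw ⟨0, mem_ball_self one_pos, by rw [hf0, h]⟩
  rw [mem_ball_zero_iff] at hw4
  obtain ⟨ρ, hwρ, hρ⟩ := exists_between (show 4 * ‖w‖ < 1 by linarith)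
  obtain ⟨C, hC0, hC⟩ := exists_lt_norm_of_injOn hf hinj hf0 hf1 hρ
  have hρ0 : 0 < ρ := (by positivity : 0 ≤ 4 * ‖w‖).trans_lt hwρ
  have hlim : ∀ r, 0 < r → r ≤ ρ → ρ ≤ 4 * ‖w‖ + (4 * ‖w‖ * C + 3) * r := by
    intro r hr hrρ
    have hsub : f '' (ball 0 ρ \ closedBall 0 r) ⊆ {ζ : ℂ | (r⁻¹ + C)⁻¹ < ‖ζ‖} := by
      rintro _ ⟨z, hz, rfl⟩
      exact hC r hr z hz
    have h := (lintegral_annulus_inv_norm_sq_le_lintegral_image hf hinj hf0 hf1 hw hr.le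
      hρ.le).trans ((lintegral_mono_set hsub).trans (lintegral_norm_gt_le hw0 (by positivity)))
    have hT : 1 ≤ 4 * ‖w‖ / (r⁻¹ + C)⁻¹ + 3 := by
      have : 0 ≤ 4 * ‖w‖ / (r⁻¹ + C)⁻¹ := by positivity
      linarith
    rw [lintegral_annulus_inv_norm_sq hr hrρ, ENNReal.ofReal_le_ofReal_iff
        (mul_nonneg (by positivity) (Real.log_nonneg hT)),
      mul_le_mul_iff_right₀ (by positivity), Real.log_le_log_iff (by positivity) (by positivity),
      div_le_iff₀ hr, div_inv_eq_mul] at h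
    refine h.trans_eq ?_
    field_simp
    ring
  have hD : 3 ≤ 4 * ‖w‖ * C + 3 := le_add_of_nonneg_left (by positivity)
  have hδ : 0 < ρ - 4 * ‖w‖ := sub_pos.2 hwρ
  have h := hlim ((ρ - 4 * ‖w‖) / (2 * (4 * ‖w‖ * C + 3))) (by positivity) (by
    rw [div_le_iff₀ (by positivity)]
    nlinarith [norm_nonneg w])
  have hhalf : (4 * ‖w‖ * C + 3) * ((ρ - 4 * ‖w‖) / (2 * (4 * ‖w‖ * C + 3))) =
      (ρ - 4 * ‖w‖) / 2 := by
    field_simp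
  linarith
end

section
/- Let f belong to the class S and let z ∈ 𝔻 with |z| = r < 1. Then the derivative f'(z) is nonzero and |z·f''(z)/f'(z) − 2r²/(1−r²)| ≤ 4r/(1−r²). -/
open Metric
open MeasureTheory Set Real Filter Topology ComplexConjugate

/-- The mean of `‖-z⁻² + q z‖²` over a circle is bounded below by its first two Parseval terms. -/
lemma le_circleAverage_norm_neg_inv_sq_add {q : ℂ → ℂ} (hq : DifferentiableOn ℂ q (ball 0 1))
    {t : ℝ} (ht0 : 0 < t) (ht1 : t < 1) :
    (t ^ 4)⁻¹ + ‖q 0‖ ^ 2 ≤ circleAverage (fun z ↦ ‖-(z ^ 2)⁻¹ + q z‖ ^ 2) 0 t := by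
  set H : ℂ → ℂ := fun z ↦ ((t ^ 4)⁻¹ + ‖q 0‖ ^ 2 : ℝ) +
    2 * (-(z ^ 2 * q z * ((t ^ 4)⁻¹ : ℝ)) + conj (q 0) * (q z - q 0)) with hH
  have hsub : closedBall (0 : ℂ) t ⊆ ball 0 1 := closedBall_subset_ball ht1
  have hHd : DifferentiableOn ℂ H (ball 0 1) := by fun_prop
  have hHavg : circleAverage H 0 t = H 0 := by
    apply DiffContOnCl.circleAverage
    rw [abs_of_pos ht0]
    exact (hHd.mono hsub).diffContOnCl_ball subset_rfl
  have hsph : sphere (0 : ℂ) |t| ⊆ ball 0 1 := by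
    rw [abs_of_pos ht0]; exact sphere_subset_closedBall.trans hsub
  have hHc : ContinuousOn H (sphere 0 |t|) := hHd.continuousOn.mono hsph
  have hqc : ContinuousOn q (sphere 0 |t|) := hq.continuousOn.mono hsph
  have hre : circleAverage (Complex.reCLM ∘ H) 0 t = (t ^ 4)⁻¹ + ‖q 0‖ ^ 2 := by
    rw [ContinuousLinearMap.circleAverage_comp_comm _ hHc.circleIntegrable', hHavg]
    simp [hH, -Complex.ofReal_add, -Complex.ofReal_pow, -Complex.ofReal_inv]
  rw [← hre]
  refine circleAverage_mono ?_ ?_ ?_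
  · exact (Complex.reCLM.continuous.comp_continuousOn hHc).circleIntegrable'
  · refine ContinuousOn.circleIntegrable' ?_
    refine ((ContinuousOn.inv₀ (by fun_prop) ?_).neg.add hqc).norm.pow 2
    intro x hx
    have : ‖x‖ = t := by simpa [abs_of_pos ht0] using hx
    have : x ≠ 0 := by rw [← norm_pos_iff]; linarith
    positivity
  · intro z hz
    have hzt : ‖z‖ = t := by simpa [abs_of_pos ht0] using hz
    have hz0 : z ≠ 0 := by rw [← norm_pos_iff]; linarith
    have hinv : (z ^ 2)⁻¹ = conj (z ^ 2) * ((t ^ 4)⁻¹ : ℝ) := by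
      rw [Complex.inv_def, Complex.normSq_eq_norm_sq, norm_pow, hzt]
      push_cast; ring
    have hn : ‖conj (z ^ 2) * ((t ^ 4)⁻¹ : ℝ)‖ ^ 2 = (t ^ 4)⁻¹ := by
      rw [norm_mul, Complex.norm_conj, norm_pow, hzt, Complex.norm_real, norm_inv, norm_pow,
        Real.norm_of_nonneg ht0.le]
      field_simp
    simp only [hH, Function.comp]
    rw [hinv]
    generalize hw : z ^ 2 = w at *
    generalize hT : (t ^ 4)⁻¹ = T at *
    rw [← Complex.normSq_eq_norm_sq, Complex.normSq_apply] at hn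
    simp only [← Complex.normSq_eq_norm_sq, Complex.normSq_apply]
    simp at hn ⊢
    generalize q z = a at *
    generalize q 0 = b at *
    nlinarith [sq_nonneg (a.re - b.re), sq_nonneg (a.im - b.im)]

/-- Integration over the plane in polar coordinates, radius outside. -/
lemma lintegral_eq_lintegral_circleMap {f : ℂ → ENNReal} (hf : Measurable f) :
    ∫⁻ z, f z = ∫⁻ t in Ioi (0 : ℝ), ∫⁻ θ in Ioo (-π) π, ENNReal.ofReal t * f (circleMap 0 t θ) := by
  rw [← Complex.lintegral_comp_polarCoord_symm, polarCoord_target,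
    Measure.volume_eq_prod, ← Measure.prod_restrict, lintegral_prod]
  · simp [circleMap, Complex.exp_mul_I]
  · have : Measurable fun p : ℝ × ℝ ↦ Complex.polarCoord.symm p := by
      simp only [Complex.polarCoord_symm_apply]; fun_prop
    simp only [smul_eq_mul]
    fun_prop

/-- Integration over the plane in polar coordinates, angle outside. -/
lemma lintegral_eq_lintegral_circleMap_symm {f : ℂ → ENNReal} (hf : Measurable f) :
    ∫⁻ z, f z = ∫⁻ θ in Ioo (-π) π, ∫⁻ t in Ioi (0 : ℝ), ENNReal.ofReal t * f (circleMap 0 t θ) := by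
  rw [lintegral_eq_lintegral_circleMap hf, lintegral_lintegral_swap]
  have : Measurable fun p : ℝ × ℝ ↦ circleMap 0 p.1 p.2 := by
    simp only [circleMap]; fun_prop
  unfold Function.uncurry
  fun_prop

lemma conj_circleMap_div {t : ℝ} (ht : 0 < t) (θ : ℝ) :
    conj (circleMap 0 t θ) / circleMap 0 t θ = Real.cos (2 * θ) - Real.sin (2 * θ) * Complex.I := by
  have ht' : (t : ℂ) ≠ 0 := by exact_mod_cast ht.ne'
  have h : circleMap 0 t θ = t * Complex.exp (θ * Complex.I) := by simp [circleMap]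
  have e : Complex.exp (θ * Complex.I) ≠ 0 := Complex.exp_ne_zero _
  rw [h, map_mul, Complex.conj_ofReal, ← Complex.exp_conj, mul_div_mul_left _ _ ht',
    ← Complex.exp_sub]
  simp only [map_mul, Complex.conj_ofReal, Complex.conj_I]
  rw [show (θ : ℂ) * -Complex.I - θ * Complex.I = ((-(2 * θ) : ℝ) : ℂ) * Complex.I by
    push_cast; ring, Complex.exp_mul_I, ← Complex.ofReal_cos, ← Complex.ofReal_sin]
  simp
  ring

lemma re_mul_conj_circleMap_div (c : ℂ) {t : ℝ} (ht : 0 < t) (θ : ℝ) :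
    (c * (conj (circleMap 0 t θ) / circleMap 0 t θ)).re =
      c.re * Real.cos (2 * θ) + c.im * Real.sin (2 * θ) := by
  rw [conj_circleMap_div ht, Complex.mul_re]
  simp [-Complex.ofReal_cos, -Complex.ofReal_sin]

/-- The area of a near-elliptic region, described in polar coordinates. -/
lemma volume_setOf_norm_sq_le {A : ℝ} {c : ℂ} (hA : 2 * ‖c‖ ≤ A) :
    volume {u : ℂ | ‖u‖ ^ 2 ≤ A + 2 * (c * (conj u / u)).re} ≤ ENNReal.ofReal (π * A) := by
  set E : Set ℂ := {u : ℂ | ‖u‖ ^ 2 ≤ A + 2 * (c * (conj u / u)).re} with hE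
  have hEm : MeasurableSet E := by
    apply measurableSet_le
    · fun_prop
    · have : Measurable fun u : ℂ ↦ c * (conj u / u) := by
        have := Complex.continuous_conj.measurable
        fun_prop
      fun_prop
  set B : ℝ → ℝ := fun θ ↦ A + 2 * (c.re * Real.cos (2 * θ) + c.im * Real.sin (2 * θ)) with hB
  have hB0 : ∀ θ, 0 ≤ B θ := by
    intro θ
    have h1 := Complex.abs_re_le_norm (c * (conj (circleMap 0 1 θ) / circleMap 0 1 θ))
    rw [norm_mul, norm_div, Complex.norm_conj, div_self (by simp), mul_one,
      re_mul_conj_circleMap_div _ one_pos] at h1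
    have := (abs_le.mp h1).1
    simp only [hB]
    linarith
  rw [← lintegral_indicator_one hEm,
    lintegral_eq_lintegral_circleMap_symm (measurable_one.indicator hEm)]
  calc _ ≤ ∫⁻ θ in Ioo (-π) π, ENNReal.ofReal (B θ / 2) := by
        refine lintegral_mono fun θ ↦ ?_
        calc _ ≤ ∫⁻ t in Ioi (0 : ℝ), (Ioc 0 √(B θ)).indicator (fun t ↦ ENNReal.ofReal t) t := by
              refine setLIntegral_mono' measurableSet_Ioi fun t ht ↦ ?_
              by_cases h : circleMap 0 t θ ∈ E
              · have : t ∈ Ioc 0 √(B θ) := by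
                  refine ⟨ht, Real.le_sqrt_of_sq_le ?_⟩
                  simp only [hE, mem_ofPred_eq, re_mul_conj_circleMap_div c ht] at h
                  simpa [hB] using h
                simp [h, this]
              · simp [h]
          _ ≤ ∫⁻ t in Ioc 0 √(B θ), ENNReal.ofReal t := by
              rw [← lintegral_indicator measurableSet_Ioc]
              exact setLIntegral_le_lintegral _ _
          _ = ENNReal.ofReal (∫ t in Ioc 0 √(B θ), t) := by
              rw [ofReal_integral_eq_lintegral_ofReal]
              · exact (continuous_id.integrableOn_Icc).mono_set Ioc_subset_Icc_self
              · exact ae_restrict_of_forall_mem measurableSet_Ioc fun t ht ↦ ht.1.le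
          _ = ENNReal.ofReal (B θ / 2) := by
              rw [← intervalIntegral.integral_of_le (Real.sqrt_nonneg _), integral_id,
                Real.sq_sqrt (hB0 θ)]
              simp
    _ = ENNReal.ofReal (∫ θ in Ioo (-π) π, B θ / 2) := by
        rw [ofReal_integral_eq_lintegral_ofReal]
        · refine (Continuous.integrableOn_Icc ?_).mono_set Ioo_subset_Icc_self
          fun_prop
        · exact .of_forall fun θ ↦ by have := hB0 θ; simp only [Pi.zero_apply]; positivity
    _ = ENNReal.ofReal (π * A) := by
        congr 1
        rw [← integral_Ioc_eq_integral_Ioo, ← intervalIntegral.integral_of_le (by linarith [pi_pos])]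
        have h1 : ∫ θ in (-π)..π, Real.cos (2 * θ) = 0 := by
          rw [intervalIntegral.integral_comp_mul_left _ two_ne_zero]; simp [Real.sin_two_pi]
        have h2 : ∫ θ in (-π)..π, Real.sin (2 * θ) = 0 := by
          rw [intervalIntegral.integral_comp_mul_left _ two_ne_zero]; simp
        have h3 : ∀ θ, B θ / 2 = A / 2 + (c.re * Real.cos (2 * θ) + c.im * Real.sin (2 * θ)) := by
          intro θ; simp only [hB]; ring
        simp_rw [h3]
        rw [intervalIntegral.integral_add, intervalIntegral.integral_add,
          intervalIntegral.integral_const_mul, intervalIntegral.integral_const_mul, h1, h2]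
        · simp; ring
        all_goals exact Continuous.intervalIntegrable (by fun_prop) _ _

lemma ofReal_le_lintegral_circleMap {q : ℂ → ℂ} (hq : DifferentiableOn ℂ q (ball 0 1))
    {t : ℝ} (ht0 : 0 < t) (ht1 : t < 1) :
    ENNReal.ofReal (2 * π * ((t ^ 4)⁻¹ + ‖q 0‖ ^ 2)) ≤ ∫⁻ θ in Ioo (-π) π,
      ENNReal.ofReal (‖-(circleMap 0 t θ ^ 2)⁻¹ + q (circleMap 0 t θ)‖ ^ 2) := by
  have hcont : Continuous fun θ ↦ ‖-(circleMap 0 t θ ^ 2)⁻¹ + q (circleMap 0 t θ)‖ ^ 2 := by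
    have h1 : Continuous fun θ ↦ q (circleMap 0 t θ) := by
      refine hq.continuousOn.comp_continuous (continuous_circleMap 0 t) fun θ ↦ ?_
      simpa [abs_of_pos ht0] using ht1
    have h2 : Continuous fun θ ↦ (circleMap 0 t θ ^ 2)⁻¹ := by
      refine ((continuous_circleMap 0 t).pow 2).inv₀ fun θ ↦ ?_
      exact pow_ne_zero _ (circleMap_ne_center ht0.ne')
    exact (h2.neg.add h1).norm.pow 2
  rw [← ofReal_integral_eq_lintegral_ofReal
    (hcont.integrableOn_Icc.mono_set Ioo_subset_Icc_self) (.of_forall fun θ ↦ by positivity)]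
  apply ENNReal.ofReal_le_ofReal
  have h := le_circleAverage_norm_neg_inv_sq_add hq ht0 ht1
  rw [circleAverage_eq_integral_add (-π), intervalIntegral.integral_comp_add_right
    (fun θ ↦ ‖-(circleMap 0 t θ ^ 2)⁻¹ + q (circleMap 0 t θ)‖ ^ 2), zero_add,
    show 2 * π + -π = π by ring, intervalIntegral.integral_of_le (by linarith [pi_pos]),
    integral_Ioc_eq_integral_Ioo, smul_eq_mul, inv_mul_eq_div, le_div_iff₀ (by positivity)] at h
  linarith

/-- Lower bound for the area of the image of an annulus under an injective function with a simple
pole of residue `1` at the origin. -/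
lemma ofReal_le_volume_image_annulus {q G : ℂ → ℂ} (hq : DifferentiableOn ℂ q (ball 0 1))
    (hG : ∀ z ∈ ball (0 : ℂ) 1, z ≠ 0 → HasDerivAt G (-(z ^ 2)⁻¹ + q z) z)
    {ρ : ℝ} (hρ0 : 0 < ρ) (hρ1 : ρ < 1) (hinj : InjOn G {z | ‖z‖ ∈ Ioo ρ 1}) :
    ENNReal.ofReal (π * ((ρ ^ 2)⁻¹ - 1 + ‖q 0‖ ^ 2 * (1 - ρ ^ 2))) ≤
      volume (G '' {z | ‖z‖ ∈ Ioo ρ 1}) := by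
  set S : Set ℂ := {z | ‖z‖ ∈ Ioo ρ 1} with hS
  have hSm : MeasurableSet S := measurable_norm measurableSet_Ioo
  have hG' : ∀ z ∈ S, HasDerivAt G (-(z ^ 2)⁻¹ + q z) z := fun z hz ↦
    hG z (by simpa using hz.2) (norm_pos_iff.mp (hρ0.trans hz.1))
  have hderiv : ∀ z ∈ S, HasFDerivWithinAt G
      ((ContinuousLinearMap.toSpanSingleton ℂ (deriv G z)).restrictScalars ℝ) S z := fun z hz ↦
    ((hG' z hz).differentiableAt.hasDerivAt.hasFDerivAt.restrictScalars ℝ).hasFDerivWithinAt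
  have hdet : ∀ a : ℂ, |((ContinuousLinearMap.toSpanSingleton ℂ a).restrictScalars ℝ).det| =
      ‖a‖ ^ 2 := by
    intro a
    simp [ContinuousLinearMap.det, LinearMap.det_restrictScalars, Algebra.norm_complex_eq,
      Complex.normSq_eq_norm_sq]
  rw [← lintegral_abs_det_fderiv_eq_addHaar_image volume hSm hderiv hinj]
  simp only [hdet]
  rw [← lintegral_indicator hSm, lintegral_eq_lintegral_circleMap
    (Measurable.indicator (by have := measurable_deriv G; fun_prop) hSm)]
  calc ENNReal.ofReal (π * ((ρ ^ 2)⁻¹ - 1 + ‖q 0‖ ^ 2 * (1 - ρ ^ 2)))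
      = ENNReal.ofReal (∫ t in Ioo ρ 1, t * (2 * π * ((t ^ 4)⁻¹ + ‖q 0‖ ^ 2))) := by
        congr 1
        rw [← integral_Ioc_eq_integral_Ioo, ← intervalIntegral.integral_of_le hρ1.le]
        have hpos : ∀ t ∈ uIcc ρ 1, 0 < t := fun t ht ↦ by
          rw [uIcc_of_le hρ1.le] at ht; exact hρ0.trans_le ht.1
        rw [intervalIntegral.integral_eq_sub_of_hasDerivAt
          (f := fun t ↦ π * (-(t ^ 2)⁻¹ + ‖q 0‖ ^ 2 * t ^ 2))]
        · field_simp; ring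
        · intro t ht
          have ht := (hpos t ht).ne'
          convert! ((((hasDerivAt_pow 2 t).inv (pow_ne_zero 2 ht)).neg.add
            ((hasDerivAt_pow 2 t).const_mul (‖q 0‖ ^ 2))).const_mul π) using 1
          field_simp
          norm_num [mul_comm]
        · refine ContinuousOn.intervalIntegrable ?_
          refine continuousOn_id.mul (continuousOn_const.mul (ContinuousOn.add ?_ continuousOn_const))
          exact (continuousOn_pow 4).inv₀ fun t ht ↦ pow_ne_zero _ (hpos t ht).ne'
    _ = ∫⁻ t in Ioo ρ 1, ENNReal.ofReal (t * (2 * π * ((t ^ 4)⁻¹ + ‖q 0‖ ^ 2))) := by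
        rw [ofReal_integral_eq_lintegral_ofReal]
        · refine (ContinuousOn.integrableOn_Icc ?_).mono_set Ioo_subset_Icc_self
          refine continuousOn_id.mul (continuousOn_const.mul (ContinuousOn.add ?_ continuousOn_const))
          exact (continuousOn_pow 4).inv₀ fun t ht ↦ pow_ne_zero _ (hρ0.trans_le ht.1).ne'
        · refine ae_restrict_of_forall_mem measurableSet_Ioo fun t ht ↦ ?_
          have := hρ0.trans ht.1
          simp only [Pi.zero_apply]; positivity
    _ ≤ ∫⁻ t in Ioo ρ 1, ∫⁻ θ in Ioo (-π) π, ENNReal.ofReal t *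
          S.indicator (fun z ↦ ENNReal.ofReal (‖deriv G z‖ ^ 2)) (circleMap 0 t θ) := by
        refine setLIntegral_mono' measurableSet_Ioo fun t ht ↦ ?_
        have ht0 := hρ0.trans ht.1
        have hmem : ∀ θ, circleMap 0 t θ ∈ S := fun θ ↦ by
          simpa [hS, abs_of_pos ht0] using ht
        simp only [hmem, indicator_of_mem, (hG' _ (hmem _)).deriv]
        rw [ENNReal.ofReal_mul ht0.le, lintegral_const_mul' _ _ ENNReal.ofReal_ne_top]
        gcongr
        exact ofReal_le_lintegral_circleMap hq ht0 ht.2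
    _ ≤ _ := lintegral_mono_set fun t ht ↦ hρ0.trans ht.1

lemma norm_sq_div_sub_le {z V c d : ℂ} (hz : z ≠ 0) (hVd : V = 1 + d * z ^ 2) :
    ‖V / z‖ ^ 2 - (‖z‖ ^ 2)⁻¹ - 2 * (c * (conj (V / z) / (V / z))).re ≤
      2 * ‖d - c * (conj V / V)‖ + ‖d‖ ^ 2 * ‖z‖ ^ 2 := by
  have hz' : conj z ≠ 0 := by simpa using hz
  have hn : 0 < ‖z‖ := norm_pos_iff.mpr hz
  have hzz : z * conj z = (‖z‖ ^ 2 : ℝ) := by rw [Complex.mul_conj, Complex.normSq_eq_norm_sq]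
  have h1 : conj (V / z) / (V / z) = conj V / V * (z / conj z) := by
    rw [map_div₀, div_div_div_eq]; rw [div_mul_div_comm]; ring
  have h2 : ‖V / z‖ ^ 2 - (‖z‖ ^ 2)⁻¹ = 2 * (d * (z / conj z)).re + ‖d‖ ^ 2 * ‖z‖ ^ 2 := by
    have h3 : d * (z / conj z) = d * z ^ 2 * ((‖z‖ ^ 2 : ℝ) : ℂ)⁻¹ := by
      rw [← hzz]; field_simp
    have h4 : ‖V‖ ^ 2 = 1 + 2 * (d * z ^ 2).re + ‖d‖ ^ 2 * ‖z‖ ^ 4 := by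
      have : ‖d‖ ^ 2 * ‖z‖ ^ 4 = ‖d * z ^ 2‖ ^ 2 := by rw [norm_mul, norm_pow]; ring
      rw [this, hVd, ← Complex.normSq_eq_norm_sq, ← Complex.normSq_eq_norm_sq, Complex.normSq_add]
      generalize d * z ^ 2 = w
      simp
      ring
    rw [norm_div, div_pow, h4, h3, ← Complex.ofReal_inv, Complex.re_mul_ofReal]
    field_simp
    ring
  have h5 : (d * (z / conj z)).re - (c * (conj V / V * (z / conj z))).re ≤
      ‖d - c * (conj V / V)‖ := by
    rw [← Complex.sub_re]
    refine (Complex.re_le_norm _).trans (le_of_eq ?_)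
    rw [show d * (z / conj z) - c * (conj V / V * (z / conj z)) =
      (d - c * (conj V / V)) * (z / conj z) by ring, norm_mul, norm_div, Complex.norm_conj,
      div_self hn.ne', mul_one]
  rw [h1, h2]
  linarith

/-- An injective holomorphic function vanishing at the origin is bounded below away from it. -/
lemma exists_pos_forall_le_norm {h : ℂ → ℂ} (hd : DifferentiableOn ℂ h (ball 0 1))
    (hinj : InjOn h (ball 0 1)) (h0 : h 0 = 0) {δ : ℝ} (hδ : 0 < δ) :
    ∃ η > 0, ∀ z ∈ ball (0 : ℂ) 1, δ ≤ ‖z‖ → η ≤ ‖h z‖ := by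
  have hnhds : ball (0 : ℂ) 1 ∈ 𝓝 0 := ball_mem_nhds _ one_pos
  rcases (hd.analyticAt hnhds).eventually_constant_or_nhds_le_map_nhds with hc | ho
  · exfalso
    have h1 : ∀ᶠ z in 𝓝[≠] (0 : ℂ), False := by
      filter_upwards [hc.filter_mono nhdsWithin_le_nhds, self_mem_nhdsWithin,
        mem_nhdsWithin_of_mem_nhds hnhds] with z hz hz0 hzb
      exact hz0 (hinj hzb (mem_ball_self one_pos) hz)
    simpa using h1.exists
  · have h1 : h '' (ball 0 (min δ 1)) ∈ 𝓝 (h 0) :=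
      ho (image_mem_map (ball_mem_nhds _ (lt_min hδ one_pos)))
    rw [h0] at h1
    obtain ⟨η, hη, hsub⟩ := Metric.mem_nhds_iff.mp h1
    refine ⟨η, hη, fun z hz hzδ ↦ ?_⟩
    by_contra! hlt
    obtain ⟨w, hw, hwz⟩ := hsub (show h z ∈ ball 0 η by simpa using hlt)
    have hw' : ‖w‖ < δ ∧ ‖w‖ < 1 := by simpa using hw
    have : w = z := hinj (by simpa using hw'.2) hz hwz
    subst this
    linarith [hw'.1]

lemma eventually_norm_sq_le {v : ℂ → ℂ} (hv : DifferentiableOn ℂ v (ball 0 1))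
    (hv0 : v 0 = 1) (hvne : ∀ z ∈ ball (0 : ℂ) 1, v z ≠ 0)
    (hinj : InjOn (fun z ↦ z / v (z ^ 2)) (ball 0 1)) {ε : ℝ} (hε : 0 < ε) :
    ∀ᶠ ρ in 𝓝[>] (0 : ℝ), ∀ z : ℂ, ‖z‖ ∈ Ioo ρ 1 → ‖v (z ^ 2) / z‖ ^ 2 ≤
      ((ρ ^ 2)⁻¹ + ε) + 2 * (deriv v 0 * (conj (v (z ^ 2) / z) / (v (z ^ 2) / z))).re := by
  have hnhds : ball (0 : ℂ) 1 ∈ 𝓝 0 := ball_mem_nhds _ one_pos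
  set c := deriv v 0 with hc
  have hsq : ContinuousAt (fun z : ℂ ↦ z ^ 2) 0 := by fun_prop
  have hmaps : MapsTo (fun z : ℂ ↦ z ^ 2) (ball 0 1) (ball 0 1) := fun z hz ↦ by
    have : ‖z‖ < 1 := by simpa using hz
    simpa using pow_lt_one₀ (norm_nonneg _) this two_ne_zero
  have hvd : DifferentiableAt ℂ v 0 := hv.differentiableAt hnhds
  have hV : ContinuousAt (fun z : ℂ ↦ v (z ^ 2)) 0 :=
    ContinuousAt.comp_of_eq hvd.continuousAt hsq (by simp)
  have hD : ContinuousAt (fun z : ℂ ↦ dslope v 0 (z ^ 2)) 0 :=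
    ContinuousAt.comp_of_eq (continuousAt_dslope_same.mpr hvd) hsq (by simp)
  have hR : ContinuousAt (fun z : ℂ ↦ 2 * ‖dslope v 0 (z ^ 2) -
      c * (conj (v (z ^ 2)) / v (z ^ 2))‖ + ‖dslope v 0 (z ^ 2)‖ ^ 2 * ‖z‖ ^ 2) 0 := by
    have h1 : ContinuousAt (fun z : ℂ ↦ conj (v (z ^ 2)) / v (z ^ 2)) 0 :=
      (Complex.continuous_conj.continuousAt.comp hV).div hV (by simp [hv0])
    fun_prop
  have hlim : ∀ᶠ z in 𝓝 (0 : ℂ), 2 * ‖dslope v 0 (z ^ 2) -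
      c * (conj (v (z ^ 2)) / v (z ^ 2))‖ + ‖dslope v 0 (z ^ 2)‖ ^ 2 * ‖z‖ ^ 2 < ε := by
    refine hR.eventually_lt continuousAt_const ?_
    simpa [hv0, hc] using hε
  obtain ⟨δ, hδ, hnear⟩ := Metric.eventually_nhds_iff.mp hlim
  have hhd : DifferentiableOn ℂ (fun z ↦ z / v (z ^ 2)) (ball 0 1) :=
    differentiableOn_id.div (hv.comp (by fun_prop) hmaps) fun z hz ↦ hvne _ (hmaps hz)
  obtain ⟨η, hη, hfar⟩ := exists_pos_forall_le_norm hhd hinj (by simp) hδ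
  have htend : Tendsto (fun ρ : ℝ ↦ (ρ ^ 2)⁻¹) (𝓝[>] 0) atTop := by
    simpa [Function.comp_def] using (tendsto_pow_atTop two_ne_zero).comp (tendsto_inv_nhdsGT_zero (𝕜 := ℝ))
  filter_upwards [htend.eventually_ge_atTop ((η ^ 2)⁻¹ + 2 * ‖c‖), self_mem_nhdsWithin]
    with ρ hρ hρ0 z hz
  have hρ0 : 0 < ρ := hρ0
  have hzpos : 0 < ‖z‖ := hρ0.trans hz.1
  have hz0 : z ≠ 0 := norm_pos_iff.mp hzpos
  rcases lt_or_ge ‖z‖ δ with hzδ | hzδ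
  · have h1 := norm_sq_div_sub_le (c := c) (V := v (z ^ 2)) (d := dslope v 0 (z ^ 2)) hz0 (by
      have := sub_smul_dslope v 0 (z ^ 2)
      rw [hv0, smul_eq_mul, sub_zero] at this
      linear_combination -this)
    have h2 := hnear (show dist z 0 < δ by simpa using hzδ)
    have h3 : (‖z‖ ^ 2)⁻¹ ≤ (ρ ^ 2)⁻¹ := by
      have := hz.1.le
      gcongr
    linarith
  · have hfz := hfar z (by simpa using hz.2) hzδ
    set u := v (z ^ 2) / z with hu
    have h1 : ‖u‖ ≤ η⁻¹ := by
      rw [hu, ← inv_div, norm_inv]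
      exact inv_anti₀ hη hfz
    have h2 : ‖u‖ ^ 2 ≤ (η ^ 2)⁻¹ := by
      rw [← inv_pow]; gcongr
    have h3 : -‖c‖ ≤ (c * (conj u / u)).re := by
      have h4 := (abs_le.mp (Complex.abs_re_le_norm (c * (conj u / u)))).1
      have h5 : ‖c * (conj u / u)‖ ≤ ‖c‖ := by
        rw [norm_mul, norm_div, Complex.norm_conj]
        exact mul_le_of_le_one_right (norm_nonneg _) (div_self_le_one _)
      linarith
    linarith

/-- The area theorem for the first coefficient of an odd function `v (z ^ 2) / z`. -/
lemma norm_deriv_zero_le_one {v : ℂ → ℂ} (hv : DifferentiableOn ℂ v (ball 0 1))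
    (hv0 : v 0 = 1) (hvne : ∀ z ∈ ball (0 : ℂ) 1, v z ≠ 0)
    (hinj : InjOn (fun z ↦ z / v (z ^ 2)) (ball 0 1)) : ‖deriv v 0‖ ≤ 1 := by
  have hnhds : ball (0 : ℂ) 1 ∈ 𝓝 0 := ball_mem_nhds _ one_pos
  set c := deriv v 0 with hc
  have hmaps : MapsTo (fun z : ℂ ↦ z ^ 2) (ball 0 1) (ball 0 1) := fun z hz ↦ by
    have : ‖z‖ < 1 := by simpa using hz
    simpa using pow_lt_one₀ (norm_nonneg _) this two_ne_zero
  have hq : DifferentiableOn ℂ (fun z ↦ -dslope v 0 (z ^ 2) + 2 * deriv v (z ^ 2))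
      (ball 0 1) := by
    have h1 : DifferentiableOn ℂ (fun z ↦ dslope v 0 (z ^ 2)) (ball 0 1) :=
      ((Complex.differentiableOn_dslope hnhds).mpr hv).comp (by fun_prop) hmaps
    have h2 : DifferentiableOn ℂ (fun z ↦ deriv v (z ^ 2)) (ball 0 1) :=
      (hv.deriv isOpen_ball).comp (by fun_prop) hmaps
    fun_prop
  have hG : ∀ z ∈ ball (0 : ℂ) 1, z ≠ 0 → HasDerivAt (fun z ↦ v (z ^ 2) / z)
      (-(z ^ 2)⁻¹ + (-dslope v 0 (z ^ 2) + 2 * deriv v (z ^ 2))) z := by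
    intro z hz hz0
    have hvz := (hv.differentiableAt (isOpen_ball.mem_nhds (hmaps hz))).hasDerivAt
    convert! (HasDerivAt.comp z hvz (hasDerivAt_pow 2 z)).div (hasDerivAt_id z) hz0 using 1
    have h1 : v (z ^ 2) = 1 + z ^ 2 * dslope v 0 (z ^ 2) := by
      have := sub_smul_dslope v 0 (z ^ 2)
      rw [hv0, smul_eq_mul, sub_zero] at this
      linear_combination -this
    simp only [Function.comp, id, h1]
    field_simp
    push_cast
    ring
  have hGinj : InjOn (fun z ↦ v (z ^ 2) / z) (ball 0 1) := by
    intro z hz w hw hzw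
    refine hinj hz hw ?_
    have := congrArg (·⁻¹) hzw
    simpa using this
  have hid : Tendsto (fun ρ : ℝ ↦ ρ) (𝓝[>] 0) (𝓝 0) := nhdsWithin_le_nhds
  have key : ∀ ε > 0, ‖c‖ ^ 2 ≤ 1 + ε := by
    intro ε hε
    have htend : Tendsto (fun ρ : ℝ ↦ (ρ ^ 2)⁻¹) (𝓝[>] 0) atTop := by
      simpa [Function.comp_def] using
        (tendsto_pow_atTop two_ne_zero).comp (tendsto_inv_nhdsGT_zero (𝕜 := ℝ))
    have hev : ∀ᶠ ρ in 𝓝[>] (0 : ℝ), ‖c‖ ^ 2 * (1 - ρ ^ 2) ≤ 1 + ε := by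
      filter_upwards [eventually_norm_sq_le hv hv0 hvne hinj hε, self_mem_nhdsWithin,
        hid.eventually_lt_const one_pos, htend.eventually_ge_atTop (2 * ‖c‖)]
        with ρ hρ hρ0 hρ1 hρA
      have hρ0 : 0 < ρ := hρ0
      have h1 := ofReal_le_volume_image_annulus hq hG hρ0 hρ1
        (hGinj.mono fun z hz ↦ by simpa using hz.2)
      have hsub : (fun z ↦ v (z ^ 2) / z) '' {z | ‖z‖ ∈ Ioo ρ 1} ⊆
          {u | ‖u‖ ^ 2 ≤ ((ρ ^ 2)⁻¹ + ε) + 2 * (c * (conj u / u)).re} := by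
        rintro _ ⟨z, hz, rfl⟩
        exact hρ z hz
      have h2 := h1.trans ((measure_mono hsub).trans
        (volume_setOf_norm_sq_le (by linarith)))
      rw [ENNReal.ofReal_le_ofReal_iff (by positivity), mul_le_mul_iff_right₀ pi_pos] at h2
      have h3 : -dslope v 0 ((0 : ℂ) ^ 2) + 2 * deriv v (0 ^ 2) = c := by
        simp [hc]; ring
      rw [h3] at h2
      linarith
    refine le_of_tendsto ?_ hev
    have : Tendsto (fun ρ : ℝ ↦ ‖c‖ ^ 2 * (1 - ρ ^ 2)) (𝓝[>] 0) (𝓝 (‖c‖ ^ 2 * (1 - 0 ^ 2))) :=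
      ((hid.pow 2).const_sub 1).const_mul _
    simpa using this
  have := le_of_forall_pos_le_add key
  exact (sq_le_one_iff₀ (norm_nonneg _)).mp this

/-- A nonvanishing holomorphic function on the disc has a reciprocal square root. -/
lemma exists_sq_mul_eq_one {p : ℂ → ℂ} (hp : DifferentiableOn ℂ p (ball 0 1))
    (hne : ∀ z ∈ ball (0 : ℂ) 1, p z ≠ 0) (hp0 : p 0 = 1) :
    ∃ v : ℂ → ℂ, DifferentiableOn ℂ v (ball 0 1) ∧ v 0 = 1 ∧
      ∀ z ∈ ball (0 : ℂ) 1, v z ^ 2 * p z = 1 := by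
  obtain ⟨L, hL0, hL⟩ := (((hp.deriv isOpen_ball).div hp hne).isExactOn_ball).with_val_at 0 0
  have hLd : DifferentiableOn ℂ L (ball 0 1) := fun z hz ↦
    (hL z hz).differentiableAt.differentiableWithinAt
  refine ⟨fun z ↦ Complex.exp (-L z / 2), by fun_prop, by simp [hL0], fun z hz ↦ ?_⟩
  have hsq : ∀ z, Complex.exp (-L z / 2) ^ 2 = Complex.exp (-L z) := fun z ↦ by
    rw [← Complex.exp_nat_mul]; congr 1; push_cast; ring
  have hderiv : ∀ z ∈ ball (0 : ℂ) 1, HasDerivAt (fun z ↦ Complex.exp (-L z) * p z) 0 z := by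
    intro z hz
    have := ((hL z hz).neg.cexp).mul (hp.differentiableAt (isOpen_ball.mem_nhds hz)).hasDerivAt
    convert! this using 1
    have := hne z hz
    simp only [Pi.div_apply, Pi.neg_apply]
    field_simp
    ring
  have := isOpen_ball.is_const_of_deriv_eq_zero (convex_ball (0 : ℂ) 1).isPreconnected
    (fun z hz ↦ (hderiv z hz).differentiableAt.differentiableWithinAt)
    (fun z hz ↦ (hderiv z hz).deriv) hz (mem_ball_self one_pos)
  simp only [hsq]
  rw [this, hL0, hp0]
  simp

lemma deriv_dslope_same {F : ℂ → ℂ} {s : Set ℂ} {a : ℂ} (hs : IsOpen s) (ha : a ∈ s)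
    (hF : DifferentiableOn ℂ F s) : 2 * deriv (dslope F a) a = deriv (deriv F) a := by
  have hD : DifferentiableOn ℂ (dslope F a) s :=
    (Complex.differentiableOn_dslope (hs.mem_nhds ha)).mpr hF
  have h1 : ∀ z ∈ s, HasDerivAt F (dslope F a z + (z - a) * deriv (dslope F a) z) z := by
    intro z hz
    have h2 := ((hasDerivAt_id z).sub_const a).mul
      (hD.differentiableAt (hs.mem_nhds hz)).hasDerivAt
    have h3 : F = fun z ↦ F a + ((id z - a) * dslope F a z) := by
      funext z
      have := sub_smul_dslope F a z
      rw [smul_eq_mul] at this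
      simp [this]
    rw [h3]
    convert! h2.const_add (F a) using 1
    rw [← h3]
    simp
  have h2 : deriv F =ᶠ[𝓝 a] fun z ↦ dslope F a z + (z - a) * deriv (dslope F a) z := by
    filter_upwards [hs.mem_nhds ha] with z hz using (h1 z hz).deriv
  rw [h2.deriv_eq]
  have h3 := (hD.differentiableAt (hs.mem_nhds ha)).hasDerivAt
  have h4 := ((hD.deriv hs).differentiableAt (hs.mem_nhds ha)).hasDerivAt
  have h5 := h3.add (((hasDerivAt_id a).sub_const a).mul h4)
  refine Eq.trans ?_ h5.deriv.symm
  simp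
  ring

/-- **Bieberbach's theorem** on the second coefficient. -/
lemma norm_deriv_deriv_zero_le {F : ℂ → ℂ} (hF : DifferentiableOn ℂ F (ball 0 1))
    (hinj : InjOn F (ball 0 1)) (ha : deriv F 0 ≠ 0) :
    ‖deriv (deriv F) 0‖ ≤ 4 * ‖deriv F 0‖ := by
  have h0 : (0 : ℂ) ∈ ball (0 : ℂ) 1 := mem_ball_self one_pos
  have hnhds : ball (0 : ℂ) 1 ∈ 𝓝 0 := ball_mem_nhds _ one_pos
  set a := deriv F 0 with haF
  have hD : DifferentiableOn ℂ (dslope F 0) (ball 0 1) :=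
    (Complex.differentiableOn_dslope hnhds).mpr hF
  have hFD : ∀ z, z * dslope F 0 z = F z - F 0 := fun z ↦ by
    simpa using sub_smul_dslope F 0 z
  set p : ℂ → ℂ := fun z ↦ dslope F 0 z / a with hp
  have hpd : DifferentiableOn ℂ p (ball 0 1) := hD.div_const a
  have hp0 : p 0 = 1 := by simp [hp, ← haF, ha]
  have hpne : ∀ z ∈ ball (0 : ℂ) 1, p z ≠ 0 := by
    intro z hz h
    have h1 : dslope F 0 z = 0 := by simpa [hp, ha] using h
    have h2 := hFD z
    rw [h1, mul_zero] at h2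
    have h3 : z = 0 := hinj hz h0 (by linear_combination -h2)
    rw [h3, hp0] at h
    exact one_ne_zero h
  obtain ⟨v, hvd, hv0, hv⟩ := exists_sq_mul_eq_one hpd hpne hp0
  have hvne : ∀ z ∈ ball (0 : ℂ) 1, v z ≠ 0 := fun z hz h ↦ by
    have := hv z hz
    simp [h] at this
  have hmaps : MapsTo (fun z : ℂ ↦ z ^ 2) (ball 0 1) (ball 0 1) := fun z hz ↦ by
    have : ‖z‖ < 1 := by simpa using hz
    simpa using pow_lt_one₀ (norm_nonneg _) this two_ne_zero
  have hsq : ∀ z ∈ ball (0 : ℂ) 1, a * (z / v (z ^ 2)) ^ 2 = F (z ^ 2) - F 0 := by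
    intro z hz
    have h1 := hv _ (hmaps hz)
    have h2 := hvne _ (hmaps hz)
    have h3 : dslope F 0 (z ^ 2) = a * p (z ^ 2) := by simp only [hp]; field_simp
    rw [← hFD, h3]
    simp only at h1 h2
    field_simp
    linear_combination -z ^ 2 * h1
  have hhinj : InjOn (fun z ↦ z / v (z ^ 2)) (ball 0 1) := by
    intro z hz w hw hzw
    simp only at hzw
    have h1 := hsq z hz
    rw [hzw, hsq w hw] at h1
    have h2 : z ^ 2 = w ^ 2 := hinj (hmaps hz) (hmaps hw) (by linear_combination -h1)
    rcases sq_eq_sq_iff_eq_or_eq_neg.mp h2 with h3 | h3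
    · exact h3
    · rw [h2, div_left_inj' (hvne _ (hmaps hw))] at hzw
      exact hzw
  have hle := norm_deriv_zero_le_one hvd hv0 hvne hhinj
  have hd1 := (hvd.differentiableAt hnhds).hasDerivAt
  have hd2 := (hpd.differentiableAt hnhds).hasDerivAt
  have hd3 : HasDerivAt (fun z ↦ v z ^ 2 * p z) 0 0 := by
    refine (hasDerivAt_const (0 : ℂ) (1 : ℂ)).congr_of_eventuallyEq ?_
    filter_upwards [hnhds] with z hz using hv z hz
  have h4 := ((hd1.pow 2).mul hd2).unique hd3
  have h5 : deriv p 0 = deriv (dslope F 0) 0 / a := by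
    simp only [hp]; rw [deriv_div_const]
  have h6 := deriv_dslope_same isOpen_ball h0 hF
  simp only [Pi.pow_apply, hv0, hp0, h5] at h4
  have h7 : deriv (deriv F) 0 = -4 * (a * deriv v 0) := by
    rw [← h6]
    field_simp at h4
    norm_num at h4
    linear_combination 2 * h4
  rw [h7, norm_mul, norm_mul]
  norm_num
  nlinarith [norm_nonneg a]

/-- The Koebe transform of Bieberbach's theorem. -/
lemma norm_one_sub_sq_mul_deriv_deriv_sub_le {f : ℂ → ℂ} (hf : DifferentiableOn ℂ f (ball 0 1))
    (hinj : InjOn f (ball 0 1)) {z : ℂ} (hz : z ∈ ball (0 : ℂ) 1) (hfz : deriv f z ≠ 0) :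
    ‖(1 - ‖z‖ ^ 2 : ℝ) * deriv (deriv f) z - 2 * conj z * deriv f z‖ ≤ 4 * ‖deriv f z‖ := by
  have hz1 : ‖z‖ < 1 := by simpa using hz
  have hnhds : ball (0 : ℂ) 1 ∈ 𝓝 0 := ball_mem_nhds _ one_pos
  have h0 : (0 : ℂ) ∈ ball (0 : ℂ) 1 := mem_ball_self one_pos
  have hs : 0 < 1 - ‖z‖ ^ 2 := by nlinarith [norm_nonneg z]
  set s : ℂ := ((1 - ‖z‖ ^ 2 : ℝ) : ℂ) with hsdef
  have hs0 : s ≠ 0 := by rw [hsdef]; exact_mod_cast hs.ne'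
  have hsz : s = 1 - z * conj z := by
    rw [hsdef, Complex.mul_conj, Complex.normSq_eq_norm_sq]; push_cast; ring
  set φ : ℂ → ℂ := fun ζ ↦ (ζ + z) / (1 + conj z * ζ) with hφ
  have hden : ∀ ζ ∈ ball (0 : ℂ) 1, 1 + conj z * ζ ≠ 0 := by
    intro ζ hζ h
    have hζ1 : ‖ζ‖ < 1 := by simpa using hζ
    have h1 : ‖conj z * ζ‖ = 1 := by
      rw [show conj z * ζ = -1 by linear_combination h]; simp
    rw [norm_mul, Complex.norm_conj] at h1
    nlinarith [norm_nonneg z, norm_nonneg ζ]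
  have hφd : ∀ ζ ∈ ball (0 : ℂ) 1, HasDerivAt φ (s / (1 + conj z * ζ) ^ 2) ζ := by
    intro ζ hζ
    have h1 := ((hasDerivAt_id ζ).add_const z).div
      (((hasDerivAt_id ζ).const_mul (conj z)).const_add 1) (hden ζ hζ)
    convert! h1 using 1
    simp only [id, hsz]
    ring
  have hφm : MapsTo φ (ball 0 1) (ball 0 1) := by
    intro ζ hζ
    have hζ1 : ‖ζ‖ < 1 := by simpa using hζ
    have h1 := norm_pos_iff.mpr (hden ζ hζ)
    rw [mem_ball_zero_iff, hφ, norm_div, div_lt_one h1]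
    refine lt_of_pow_lt_pow_left₀ 2 h1.le ?_
    have h2 : ‖1 + conj z * ζ‖ ^ 2 - ‖ζ + z‖ ^ 2 = (1 - ‖z‖ ^ 2) * (1 - ‖ζ‖ ^ 2) := by
      simp only [← Complex.normSq_eq_norm_sq, Complex.normSq_apply]
      simp
      ring
    have h3 : 0 < 1 - ‖ζ‖ ^ 2 := by nlinarith [norm_nonneg ζ]
    nlinarith [mul_pos hs h3]
  have hφi : InjOn φ (ball 0 1) := by
    intro ζ hζ ξ hξ h
    simp only [hφ] at h
    rw [div_eq_div_iff (hden ζ hζ) (hden ξ hξ)] at h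
    have : s * (ζ - ξ) = 0 := by rw [hsz]; linear_combination h
    exact sub_eq_zero.mp ((mul_eq_zero.mp this).resolve_left hs0)
  have hφ0 : φ 0 = z := by simp [hφ]
  have hF : ∀ ζ ∈ ball (0 : ℂ) 1,
      HasDerivAt (f ∘ φ) (deriv f (φ ζ) * (s / (1 + conj z * ζ) ^ 2)) ζ := fun ζ hζ ↦
    ((hf.differentiableAt (isOpen_ball.mem_nhds (hφm hζ))).hasDerivAt).comp ζ (hφd ζ hζ)
  have hF0 : deriv (f ∘ φ) 0 = deriv f z * s := by rw [(hF 0 h0).deriv, hφ0]; simp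
  have hF2 : deriv (deriv (f ∘ φ)) 0 = s * (s * deriv (deriv f) z - 2 * conj z * deriv f z) := by
    have h1 : deriv (f ∘ φ) =ᶠ[𝓝 0] fun ζ ↦ deriv f (φ ζ) * (s / (1 + conj z * ζ) ^ 2) := by
      filter_upwards [hnhds] with ζ hζ using (hF ζ hζ).deriv
    have h2 : HasDerivAt (deriv f) (deriv (deriv f) z) (φ 0) := by
      rw [hφ0]
      exact ((hf.deriv isOpen_ball).differentiableAt (isOpen_ball.mem_nhds hz)).hasDerivAt
    have h3 : HasDerivAt (fun ζ : ℂ ↦ (1 + conj z * ζ) ^ 2) (2 * conj z) 0 := by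
      convert! (((hasDerivAt_id (0 : ℂ)).const_mul (conj z)).const_add 1).pow 2 using 1
      simp
    have h4 := (h2.comp 0 (hφd 0 h0)).mul ((hasDerivAt_const (0 : ℂ) s).div h3 (by simp))
    rw [h1.deriv_eq]
    refine h4.deriv.trans ?_
    simp [hφ0]
    ring
  have hmain := norm_deriv_deriv_zero_le (F := f ∘ φ)
    (fun ζ hζ ↦ (hF ζ hζ).differentiableAt.differentiableWithinAt)
    (hinj.comp hφi hφm) (by rw [hF0]; exact mul_ne_zero hfz hs0)
  rw [hF2, hF0, norm_mul, norm_mul] at hmain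
  have := norm_pos_iff.mpr hs0
  refine le_of_mul_le_mul_left ?_ this
  linarith

/-- A holomorphic function whose derivative it locally dominates vanishes near each of its zeros. -/
lemma eventually_eq_zero_of_norm_deriv_le {g : ℂ → ℂ} {a : ℂ} {C : ℝ}
    (hg : ∀ᶠ z in 𝓝 a, DifferentiableAt ℂ g z) (hC : ∀ᶠ z in 𝓝 a, ‖deriv g z‖ ≤ C * ‖g z‖)
    (ha : g a = 0) : ∀ᶠ z in 𝓝 a, g z = 0 := by
  obtain ⟨r, hr, hball⟩ := Metric.eventually_nhds_iff_ball.mp (hg.and hC)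
  obtain ⟨d, hd0, hdr, hdC⟩ : ∃ d > 0, d < r ∧ |C| * d < 1 := by
    refine ⟨min (r / 2) (1 / (2 * (|C| + 1))), by positivity,
      (min_le_left _ _).trans_lt (by linarith), ?_⟩
    calc |C| * min (r / 2) (1 / (2 * (|C| + 1))) ≤ |C| * (1 / (2 * (|C| + 1))) := by
          gcongr; exact min_le_right _ _
      _ < 1 := by rw [mul_one_div, div_lt_one (by positivity)]; linarith [abs_nonneg C]
  have hsub : closedBall a d ⊆ ball a r := closedBall_subset_ball hdr
  have hdiff : ∀ z ∈ closedBall a d, DifferentiableAt ℂ g z := fun z hz ↦ (hball z (hsub hz)).1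
  obtain ⟨w, hw, hmax⟩ := (isCompact_closedBall a d).exists_isMaxOn
    ⟨a, mem_closedBall_self hd0.le⟩ (f := fun z ↦ ‖g z‖)
    fun z hz ↦ (hdiff z hz).continuousAt.norm.continuousWithinAt
  have hbd : ∀ z ∈ closedBall a d, ‖deriv g z‖ ≤ |C| * ‖g w‖ := fun z hz ↦
    (hball z (hsub hz)).2.trans
      (mul_le_mul (le_abs_self C) (hmax hz) (norm_nonneg _) (abs_nonneg C))
  have h1 := (convex_closedBall a d).norm_image_sub_le_of_norm_deriv_le hdiff hbd
    (mem_closedBall_self hd0.le) hw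
  rw [ha, sub_zero] at h1
  have h2 : ‖w - a‖ ≤ d := by simpa [dist_eq_norm] using hw
  have h3 : ‖g w‖ ≤ (|C| * d) * ‖g w‖ := by
    calc ‖g w‖ ≤ |C| * ‖g w‖ * ‖w - a‖ := h1
      _ ≤ |C| * ‖g w‖ * d := by gcongr
      _ = _ := by ring
  have h4 : ‖g w‖ = 0 := by nlinarith [norm_nonneg (g w)]
  filter_upwards [closedBall_mem_nhds a hd0] with z hz
  have h5 : ‖g z‖ ≤ ‖g w‖ := hmax hz
  rw [h4] at h5
  exact norm_le_zero_iff.mp h5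

/-- The derivative of an injective holomorphic function on the disc does not vanish. -/
lemma deriv_ne_zero_of_injOn_ball {f : ℂ → ℂ} (hf : DifferentiableOn ℂ f (ball 0 1))
    (hinj : InjOn f (ball 0 1)) {z : ℂ} (hz : z ∈ ball (0 : ℂ) 1) : deriv f z ≠ 0 := by
  intro hfz
  have hnhds : ball (0 : ℂ) 1 ∈ 𝓝 z := isOpen_ball.mem_nhds hz
  have hf' := hf.deriv isOpen_ball
  have hf'' := hf'.deriv isOpen_ball
  have hnot : ¬ ∀ᶠ w in 𝓝 z, deriv f w = 0 := by
    intro h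
    obtain ⟨r, hr, hball⟩ := Metric.eventually_nhds_iff_ball.mp (h.and hnhds)
    have hconst : ∀ w ∈ ball z r, f w = f z := fun w hw ↦
      isOpen_ball.is_const_of_deriv_eq_zero (convex_ball z r).isPreconnected
        (hf.mono fun y hy ↦ (hball y hy).2) (fun y hy ↦ (hball y hy).1) hw (mem_ball_self hr)
    have : ∀ᶠ w in 𝓝[≠] z, False := by
      filter_upwards [self_mem_nhdsWithin, mem_nhdsWithin_of_mem_nhds (ball_mem_nhds z hr)]
        with w hw hwr
      exact hw (hinj (hball w hwr).2 hz (hconst w hwr))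
    simpa using this.exists
  have hne := ((hf'.analyticAt hnhds).eventually_eq_zero_or_eventually_ne_zero).resolve_left hnot
  have hc0 : ContinuousAt f z := (hf.differentiableAt hnhds).continuousAt
  have hc1 : ContinuousAt (deriv f) z := (hf'.differentiableAt hnhds).continuousAt
  have hc2 : ContinuousAt (deriv (deriv f)) z := (hf''.differentiableAt hnhds).continuousAt
  have hz1 : ‖z‖ < 1 := by simpa using hz
  have hs : 0 < 1 - ‖z‖ ^ 2 := by nlinarith [norm_nonneg z]
  set m := (1 - ‖z‖ ^ 2) / 2 with hm
  have hm0 : 0 < m := by positivity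
  have hbound : ∀ᶠ w in 𝓝[≠] z, ‖deriv (deriv f) w‖ ≤ 6 / m * ‖deriv f w‖ := by
    have hsm : ∀ᶠ w in 𝓝 z, m < 1 - ‖w‖ ^ 2 :=
      (show Continuous fun w : ℂ ↦ 1 - ‖w‖ ^ 2 by fun_prop).continuousAt.eventually_const_lt
        (by linarith)
    filter_upwards [hne, hsm.filter_mono nhdsWithin_le_nhds, mem_nhdsWithin_of_mem_nhds hnhds]
      with w hw hwm hwb
    have hw1 : ‖w‖ < 1 := by simpa using hwb
    have h1 := norm_one_sub_sq_mul_deriv_deriv_sub_le hf hinj hwb hw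
    have h2 := norm_sub_norm_le (((1 - ‖w‖ ^ 2 : ℝ) : ℂ) * deriv (deriv f) w)
      (2 * conj w * deriv f w)
    rw [norm_mul, norm_mul, norm_mul, Complex.norm_conj, Complex.norm_real,
      Real.norm_of_nonneg (by linarith)] at h2
    norm_num at h2
    have h3 : m * ‖deriv (deriv f) w‖ ≤ (1 - ‖w‖ ^ 2) * ‖deriv (deriv f) w‖ := by gcongr
    have h4 : ‖w‖ * ‖deriv f w‖ ≤ 1 * ‖deriv f w‖ := by gcongr
    rw [div_mul_eq_mul_div, le_div_iff₀ hm0]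
    push_cast at h1
    linarith
  have hz' : ‖deriv (deriv f) z‖ ≤ 6 / m * ‖deriv f z‖ :=
    le_of_tendsto_of_tendsto (hc2.norm.tendsto.mono_left nhdsWithin_le_nhds)
      ((hc1.norm.tendsto.const_mul _).mono_left nhdsWithin_le_nhds) hbound
  have hall : ∀ᶠ w in 𝓝 z, ‖deriv (deriv f) w‖ ≤ 6 / m * ‖deriv f w‖ := by
    filter_upwards [eventually_nhdsWithin_iff.mp hbound] with w hw
    by_cases h : w = z
    · rw [h]; exact hz'
    · exact hw h
  refine hnot (eventually_eq_zero_of_norm_deriv_le ?_ hall hfz)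
  filter_upwards [hnhds] with w hw using hf'.differentiableAt (isOpen_ball.mem_nhds hw)

/-- For `f` in the class `S` and `|z| = r < 1`, we have `f' z ≠ 0` and
`|z f''(z)/f'(z) - 2r²/(1-r²)| ≤ 4r/(1-r²)`. -/
theorem class_S_precise_derivative_bound (f : ℂ → ℂ)
    (hf : DifferentiableOn ℂ f (ball (0 : ℂ) 1))
    (hinj : Set.InjOn f (ball (0 : ℂ) 1))
    (hf0 : f 0 = 0) (hf1 : deriv f 0 = 1)
    (z : ℂ) (r : ℝ) (hz : ‖z‖ = r) (hr : r < 1) :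
    deriv f z ≠ 0 ∧
      ‖z * deriv (deriv f) z / deriv f z - ((2 * r ^ 2 / (1 - r ^ 2) : ℝ) : ℂ)‖ ≤
        4 * r / (1 - r ^ 2) := by
  have hzb : z ∈ ball (0 : ℂ) 1 := by simpa [hz] using hr
  have hne := deriv_ne_zero_of_injOn_ball hf hinj hzb
  refine ⟨hne, ?_⟩
  have h := norm_one_sub_sq_mul_deriv_deriv_sub_le hf hinj hzb hne
  have hr0 : 0 ≤ r := hz ▸ norm_nonneg z
  have hs : 0 < 1 - r ^ 2 := by nlinarith
  rw [hz] at h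
  have hsc : ((1 - r ^ 2 : ℝ) : ℂ) ≠ 0 := by exact_mod_cast hs.ne'
  have hzz : z * conj z = ((r ^ 2 : ℝ) : ℂ) := by
    rw [Complex.mul_conj, Complex.normSq_eq_norm_sq, hz]
  have heq : z * deriv (deriv f) z / deriv f z - ((2 * r ^ 2 / (1 - r ^ 2) : ℝ) : ℂ) =
      z * (((1 - r ^ 2 : ℝ) : ℂ) * deriv (deriv f) z - 2 * conj z * deriv f z) /
        (((1 - r ^ 2 : ℝ) : ℂ) * deriv f z) := by
    rw [show (2 * r ^ 2 / (1 - r ^ 2) : ℝ) = 2 * (r ^ 2) / (1 - r ^ 2) from rfl,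
      Complex.ofReal_div, Complex.ofReal_mul, ← hzz]
    field_simp
    push_cast
    ring
  have hd := norm_pos_iff.mpr hne
  rw [heq, norm_div, norm_mul, norm_mul, Complex.norm_real, Real.norm_of_nonneg hs.le, hz,
    div_le_div_iff₀ (by positivity) hs]
  have := mul_le_mul_of_nonneg_left h (mul_nonneg hr0 hs.le)
  linarith
end
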